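/- Let w ∈ S_n and let w_+ ∈ S_{n+1} act as w on {1,…,n} and fix n+1. Then the higher Specht polynomial F_{w_+} equals (1/s_{P(w_+)}^{Q̃(w_+)})·ε_{P(w_+)} applied to the monomial p_{P(w)}^{Q̃(w)} (the monomial in n variables attached to w), and substituting x_{n+1} = 0 into F_{w_+} yields the higher Specht polynomial F_w. -/

import Mathlib

open MvPolynomial

noncomputable section

namespace HigherSpecht

open scoped Classical

/-- A tableau: a filling of the plane (row, column), `0`-indexed, with `0` outside the diagram. -/
abbrev Tab := ℕ × ℕ → ℕ

/-- A permutation of `ℕ` represents an element of `Sₙ` (acting on `{1, …, n}`)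
when it fixes `0` and everything above `n`. -/
def SuppIn (n : ℕ) (w : Equiv.Perm ℕ) : Prop := ∀ i, i = 0 ∨ n < i → w i = i

/-- Descending locations of a permutation (one-line notation `w 1, …, w n`). -/
def DslSet (n : ℕ) (w : Equiv.Perm ℕ) : Finset ℕ :=
  (Finset.Ioo 0 n).filter fun i => w (i + 1) < w i

/-- Ascending locations of a permutation. -/
def AslSet (n : ℕ) (w : Equiv.Perm ℕ) : Finset ℕ :=
  (Finset.Ioo 0 n).filter fun i => w i < w (i + 1)

/-- The row in which the entry `i` shows up in a tableau. -/
def rowIdx (T : Tab) (i : ℕ) : ℕ := sInf {r | ∃ c, T (r, c) = i}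

/-- The column in which the entry `i` shows up in a tableau. -/
def colIdx (T : Tab) (i : ℕ) : ℕ := sInf {c | T (rowIdx T i, c) = i}

/-- The box containing the entry `i`. -/
def posOf (T : Tab) (i : ℕ) : ℕ × ℕ := (rowIdx T i, colIdx T i)

/-- Descending indices of a (standard) tableau: `i` with the row of `i+1` strictly below
the row of `i`. -/
def DsiSet (n : ℕ) (T : Tab) : Finset ℕ :=
  (Finset.Ioo 0 n).filter fun i => rowIdx T i < rowIdx T (i + 1)

/-- `Dsi^c`, the complemented descent set `{n - i | i ∈ Dsi}`. -/
def Dsic (n : ℕ) (T : Tab) : Finset ℕ := (DsiSet n T).image fun i => n - i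

/-- The entry of `ct_J(S)` at a box `c`: the number of elements of `J` smaller than the
entry of `S` at `c`. -/
def ctEntry (T : Tab) (J : Finset ℕ) (c : ℕ × ℕ) : ℕ := (J.filter fun j => j < T c).card

/-- The cocharge tableau `ct(S)` of a standard tableau. -/
def ctTab (n : ℕ) (T : Tab) : Tab := fun c => ctEntry T (DsiSet n T) c

/-- The (total) cocharge `cc(S)`: the sum of the entries of `ct(S)`. -/
def ccStat (n : ℕ) (T : Tab) : ℕ :=
  ∑ i ∈ Finset.Icc 1 n, ctEntry T (DsiSet n T) (posOf T i)

/-- `T` is a bijective filling of the given set of cells by `1, …, n` (`n` the number of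
cells), with `0` outside. -/
def IsFillingF (cells : Finset (ℕ × ℕ)) (T : Tab) : Prop :=
  (∀ c, c ∉ cells → T c = 0) ∧ Set.BijOn T ↑cells (Set.Icc 1 cells.card)

/-- A bijective filling of a Young diagram. -/
def IsFilling (μ : YoungDiagram) (T : Tab) : Prop := IsFillingF μ.cells T

/-- A standard Young tableau of shape `μ`: entries strictly increase along rows and columns. -/
def IsStandard (μ : YoungDiagram) (T : Tab) : Prop :=
  IsFilling μ T ∧ ∀ c₁ ∈ μ.cells, ∀ c₂ ∈ μ.cells,
    c₁ ≠ c₂ → c₁.1 ≤ c₂.1 → c₁.2 ≤ c₂.2 → T c₁ < T c₂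

/-! ### Robinson–Schensted -/

/-- Row insertion: insert `x` into a row, returning the new row and the bumped entry. -/
def rowInsert : ℕ → List ℕ → List ℕ × Option ℕ
  | x, [] => ([x], none)
  | x, y :: ys =>
    if x < y then (x :: ys, some y)
    else
      let p := rowInsert x ys
      (y :: p.1, p.2)

/-- Insertion of an entry into a tableau, given as a list of rows. -/
def tabInsert : List (List ℕ) → ℕ → List (List ℕ)
  | [], x => [[x]]
  | r :: rs, x =>
    match rowInsert x r with
    | (r', none) => r' :: rs
    | (r', some y) => r' :: tabInsert rs y

/-- One-line notation of `w ∈ Sₙ`. -/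
def oneLine (n : ℕ) (w : Equiv.Perm ℕ) : List ℕ := (List.range n).map fun i => w (i + 1)

/-- The insertion tableau of the first `m` letters of `w`, as a list of rows. -/
def PtabListPart (n : ℕ) (w : Equiv.Perm ℕ) (m : ℕ) : List (List ℕ) :=
  ((oneLine n w).take m).foldl tabInsert []

/-- Entry of a list-of-rows tableau at a (0-indexed) cell. -/
def listEntry (t : List (List ℕ)) (c : ℕ × ℕ) : ℕ := (t.getD c.1 []).getD c.2 0

/-- The Robinson–Schensted insertion tableau `P(w)`. -/
def Ptab (n : ℕ) (w : Equiv.Perm ℕ) : Tab := fun c => listEntry (PtabListPart n w n) c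

/-- The Robinson–Schensted recording tableau `Q(w)`: the entry of a cell is the step at
which the cell is added to the shape. -/
def Qtab (n : ℕ) (w : Equiv.Perm ℕ) : Tab := fun c =>
  sInf {m | listEntry (PtabListPart n w m) c ≠ 0}

/-! ### Schützenberger evacuation -/

/-- One step of a jeu de taquin slide into the hole at `c`. -/
def slideOnce (T : Tab) (c : ℕ × ℕ) : Tab × (ℕ × ℕ) :=
  let rc : ℕ × ℕ := (c.1, c.2 + 1)
  let dc : ℕ × ℕ := (c.1 + 1, c.2)
  if T rc = 0 ∧ T dc = 0 then (T, c)
  else if T dc = 0 ∨ (T rc ≠ 0 ∧ T rc < T dc) then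
    (Function.update (Function.update T c (T rc)) rc 0, rc)
  else
    (Function.update (Function.update T c (T dc)) dc 0, dc)

/-- Jeu de taquin slide (with fuel). -/
def slide : ℕ → Tab → ℕ × ℕ → Tab × (ℕ × ℕ)
  | 0, T, c => (T, c)
  | k + 1, T, c =>
    let p := slideOnce T c
    if p.2 = c then (T, c) else slide k p.1 p.2

/-- The Schützenberger evacuation: repeatedly delete the minimal entry, slide into the hole,
decrement the remaining entries, and record the vacated cell. -/
def evacAux : ℕ → Tab → Tab
  | 0, _ => fun _ => 0
  | m + 1, T =>
    let c0 := posOf T 1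
    let p := slide (m + 1) (Function.update T c0 0) c0
    Function.update (evacAux m fun c => p.1 c - 1) p.2 (m + 1)

/-- The evacuation tableau `ev S` of a standard tableau with `n` boxes. -/
def evac (n : ℕ) (T : Tab) : Tab := evacAux n T

/-- `Q̃(w) := ev (Q w)`. -/
def Qt (n : ℕ) (w : Equiv.Perm ℕ) : Tab := evac n (Qtab n w)

/-! ### Row and column groups, higher Specht polynomials -/

/-- The identification of `Fin n` with `{1, …, n} ⊆ ℕ`. -/
def finShift (n : ℕ) : Fin n ≃ {i : ℕ // 1 ≤ i ∧ i ≤ n} where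
  toFun j := ⟨(j : ℕ) + 1, by have := j.isLt; omega⟩
  invFun i := ⟨(i : ℕ) - 1, by have := i.2; omega⟩
  left_inv j := by apply Fin.ext; simp
  right_inv i := by apply Subtype.ext; have := i.2; simp; omega

/-- Embedding of the permutations of `Fin n` into permutations of `ℕ` (acting on `{1, …, n}`). -/
def embedPerm (n : ℕ) (σ : Equiv.Perm (Fin n)) : Equiv.Perm ℕ :=
  σ.extendDomain (finShift n)

/-- The row group `R(T)` of a filling, as a finset of permutations of `Fin n`. -/
def rowFinset (n : ℕ) (T : Tab) : Finset (Equiv.Perm (Fin n)) :=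
  Finset.univ.filter fun τ => ∀ i ∈ Finset.Icc 1 n, rowIdx T (embedPerm n τ i) = rowIdx T i

/-- The column group `C(T)` of a filling, as a finset of permutations of `Fin n`. -/
def colFinset (n : ℕ) (T : Tab) : Finset (Equiv.Perm (Fin n)) :=
  Finset.univ.filter fun σ => ∀ i ∈ Finset.Icc 1 n, colIdx T (embedPerm n σ i) = colIdx T i

/-- The row group `R(T)` as a set of permutations of `ℕ`. -/
def rowGroupSet (n : ℕ) (T : Tab) : Set (Equiv.Perm ℕ) :=
  {w | SuppIn n w ∧ ∀ i ∈ Finset.Icc 1 n, rowIdx T (w i) = rowIdx T i}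

/-- The column group `C(T)` as a set of permutations of `ℕ`. -/
def colGroupSet (n : ℕ) (T : Tab) : Set (Equiv.Perm ℕ) :=
  {w | SuppIn n w ∧ ∀ i ∈ Finset.Icc 1 n, colIdx T (w i) = colIdx T i}

/-- The Young symmetrizer `ε_T = Σ_{σ ∈ C(T)} Σ_{τ ∈ R(T)} sgn(σ) σ τ` acting on polynomials
(permutations acting by permuting the variables). -/
def epsAct (n : ℕ) (T : Tab) (p : MvPolynomial ℕ ℚ) : MvPolynomial ℕ ℚ :=
  ∑ σ ∈ colFinset n T, ∑ τ ∈ rowFinset n T,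
    (Equiv.Perm.sign σ : ℤ) • rename (⇑(embedPerm n σ * embedPerm n τ)) p

/-- The monomial `p_T^S = Π_i x_i^{h_i}`, where `h_i` is the entry of `ct S` in the box of
`T` containing `i`. -/
def pTS (n : ℕ) (T S : Tab) : MvPolynomial ℕ ℚ :=
  ∏ i ∈ Finset.Icc 1 n, X i ^ ctEntry S (DsiSet n S) (posOf T i)

/-- `s_T^S`: the order of the stabilizer of `p_T^S` in `R(T)`. -/
def sTS (n : ℕ) (T S : Tab) : ℕ :=
  ((rowFinset n T).filter fun τ =>
    rename (⇑(embedPerm n τ)) (pTS n T S) = pTS n T S).card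

/-- The higher Specht polynomial `F_T^S := ε_T p_T^S / s_T^S`. -/
def FTS (n : ℕ) (T S : Tab) : MvPolynomial ℕ ℚ :=
  ((sTS n T S : ℚ)⁻¹) • epsAct n T (pTS n T S)

/-- The higher Specht polynomial `F_w := F_{P(w)}^{Q̃(w)}` of a permutation. -/
def Fw (n : ℕ) (w : Equiv.Perm ℕ) : MvPolynomial ℕ ℚ := FTS n (Ptab n w) (Qt n w)

/-- The elementary symmetric polynomial `e_r` in the variables `x_1, …, x_n`. -/
def esym (n r : ℕ) : MvPolynomial ℕ ℚ :=
  ∑ s ∈ (Finset.Icc 1 n).powersetCard r, ∏ i ∈ s, X i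

/-- The representation `V^S`: the span of the higher Specht polynomials `F_T^S` over all
bijective fillings `T` of the given cells. -/
def VS (n : ℕ) (cells : Finset (ℕ × ℕ)) (S : Tab) : Submodule ℚ (MvPolynomial ℕ ℚ) :=
  Submodule.span ℚ {p | ∃ T : Tab, IsFillingF cells T ∧ p = FTS n T S}

/-- Multiplication of a subspace of polynomials by a fixed polynomial. -/
def polyMul (q : MvPolynomial ℕ ℚ) (V : Submodule ℚ (MvPolynomial ℕ ℚ)) :
    Submodule ℚ (MvPolynomial ℕ ℚ) :=
  Submodule.map (LinearMap.mulLeft ℚ q) V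

/-- The symmetric multiplier `Π_r e_r^{h_r}`. -/
def eProd (n : ℕ) (h : ℕ → ℕ) : MvPolynomial ℕ ℚ := ∏ r ∈ Finset.Icc 1 n, esym n r ^ h r

/-- `V^S_h := (Π_r e_r^{h_r}) V^S`. -/
def VSh (n : ℕ) (cells : Finset (ℕ × ℕ)) (S : Tab) (h : ℕ → ℕ) :
    Submodule ℚ (MvPolynomial ℕ ℚ) :=
  polyMul (eProd n h) (VS n cells S)

/-! ### The representations `R_{n,I}` -/

/-- For `i ∈ I`, `r_i := #{j ∈ {1,…,n-1} \ I : j < i}`. -/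
def rIdxI (n : ℕ) (I : Finset ℕ) (i : ℕ) : ℕ :=
  ((Finset.Ioo 0 n \ I).filter fun j => j < i).card

/-- The vector `h^S_I`, whose `r`-th entry (for `r ≥ 1`) is `#{i ∈ I \ Dsi^c(S) : r_i = r}`. -/
def hSI (n : ℕ) (I : Finset ℕ) (S : Tab) : ℕ → ℕ := fun r =>
  if 1 ≤ r then ((I \ Dsic n S).filter fun i => rIdxI n I i = r).card else 0

/-- The indicator vector `h(I,S)` of the set `I \ Dsi^c(S)`. -/
def hInd (n : ℕ) (I : Finset ℕ) (S : Tab) : ℕ → ℕ := fun r =>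
  if r ∈ I \ Dsic n S then 1 else 0

/-- `F_{w,I} := F_w · Π_{i ∈ I \ Dsl(w)} e_{r_i}`. -/
def FwI (n : ℕ) (I : Finset ℕ) (w : Equiv.Perm ℕ) : MvPolynomial ℕ ℚ :=
  Fw n w * ∏ i ∈ I \ DslSet n w, esym n (rIdxI n I i)

/-- The homogeneous version `F^hom_{w,I} := F_w · Π_{i ∈ I \ Dsl(w)} e_i`. -/
def FwIhom (n : ℕ) (I : Finset ℕ) (w : Equiv.Perm ℕ) : MvPolynomial ℕ ℚ :=
  Fw n w * ∏ i ∈ I \ DslSet n w, esym n i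

/-- The representation `R_{n,I}`: span of the `F_{w,I}` over `w` with `Dsl(w) ⊆ I`. -/
def RnI (n : ℕ) (I : Finset ℕ) : Submodule ℚ (MvPolynomial ℕ ℚ) :=
  Submodule.span ℚ {p | ∃ w : Equiv.Perm ℕ, SuppIn n w ∧ DslSet n w ⊆ I ∧ p = FwI n I w}

/-- The homogeneous representation `R^hom_{n,I}`. -/
def RnIhom (n : ℕ) (I : Finset ℕ) : Submodule ℚ (MvPolynomial ℕ ℚ) :=
  Submodule.span ℚ {p | ∃ w : Equiv.Perm ℕ, SuppIn n w ∧ DslSet n w ⊆ I ∧ p = FwIhom n I w}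

/-- The index type for the decomposition of `R_{n,I}`: pairs of a partition `λ ⊢ n` and a
standard Young tableau `S` of shape `λ` with `Dsi^c(S) ⊆ I`. -/
def SIdx (n : ℕ) (I : Finset ℕ) : Type :=
  {q : YoungDiagram × Tab // q.1.cells.card = n ∧ IsStandard q.1 q.2 ∧ Dsic n q.2 ⊆ I}

/-! ### Ordered set partitions -/

/-- The cumulative values `j_h` attached to a subset `I ⊆ {1,…,n-1}` (`j_0 = 0`,
`j_h` the `h`-th smallest element, `j_{|I|+1} = n`). -/
def jval (n : ℕ) (I : Finset ℕ) (h : ℕ) : ℕ :=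
  if h = 0 then 0 else if h ≤ I.card then (I.sort (· ≤ ·)).getD (h - 1) 0 else n

/-- The composition `comp_n I`, as a function of the index `0 ≤ h ≤ |I|`. -/
def compFun (n : ℕ) (I : Finset ℕ) (h : ℕ) : ℕ := jval n I (h + 1) - jval n I h

/-- The set `OP_{n,I}` of ordered set partitions of `{1,…,n}` into `|I| + 1` blocks whose
sizes are given by `comp_n I` (blocks indexed by `ℕ`, empty from index `|I| + 1` on). -/
def OPset (n : ℕ) (I : Finset ℕ) : Set (ℕ → Finset ℕ) :=
  {B | (∀ h, I.card + 1 ≤ h → B h = ∅) ∧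
       (∀ h₁ h₂, h₁ ≠ h₂ → Disjoint (B h₁) (B h₂)) ∧
       (∀ h ≤ I.card, (B h).card = compFun n I h) ∧
       Finset.Icc 1 n = (Finset.range (I.card + 1)).biUnion B}

/-- The natural action of a permutation on an ordered set partition. -/
def permOP (w : Equiv.Perm ℕ) (B : ℕ → Finset ℕ) : ℕ → Finset ℕ := fun h => (B h).image w

/-! ### The quotient `R_{n,k}` -/

/-- Elementary symmetric polynomials in `Fin n` variables. -/
def esymFin (n r : ℕ) : MvPolynomial (Fin n) ℚ :=
  ∑ s ∈ (Finset.univ : Finset (Fin n)).powersetCard r, ∏ i ∈ s, X i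

/-- The ideal defining `R_{n,k}`: generated by `x_i^k` and `e_r`, `n-k+1 ≤ r ≤ n`. -/
def Jnk (n k : ℕ) : Ideal (MvPolynomial (Fin n) ℚ) :=
  Ideal.span ((Set.range fun i : Fin n => (X i : MvPolynomial (Fin n) ℚ) ^ k) ∪
    {p | ∃ r, n - k + 1 ≤ r ∧ r ≤ n ∧ p = esymFin n r})

/-- The map sending `x_i` (for `1 ≤ i ≤ n`) to the corresponding variable of
`ℚ[x_1, …, x_n]`, and all other variables to `0`. -/
def toFin (n : ℕ) : MvPolynomial ℕ ℚ →ₐ[ℚ] MvPolynomial (Fin n) ℚ :=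
  aeval fun i => if h : 1 ≤ i ∧ i ≤ n then X (⟨i - 1, by omega⟩ : Fin n) else 0

/-- The quotient projection onto `R_{n,k}`. -/
def projNK (n k : ℕ) : MvPolynomial ℕ ℚ →ₐ[ℚ] (MvPolynomial (Fin n) ℚ ⧸ Jnk n k) :=
  (Ideal.Quotient.mkₐ ℚ (Jnk n k)).comp (toFin n)

/-! ### Corners, insertions and the induction/extension operators -/

/-- `v` is an external corner of `μ`. -/
def IsCorner (μ : YoungDiagram) (v : ℕ × ℕ) : Prop :=
  v ∉ μ.cells ∧ ∃ ν : YoungDiagram, ν.cells = insert v μ.cells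

/-- `S +̃ v := ev (ev S + v)`, where `+ v` places the entry `n + 1` in the box `v`. -/
def Sadd (n : ℕ) (S : Tab) (v : ℕ × ℕ) : Tab :=
  evac (n + 1) (Function.update (evac n S) v (n + 1))

/-- `δ^{S,v}`: `0` if `v` lies strictly below the row of `n` in `ev S`, and `1` otherwise. -/
def deltaSV (n : ℕ) (S : Tab) (v : ℕ × ℕ) : ℕ :=
  if rowIdx (evac n S) n < v.1 then 0 else 1

/-- `h + δ·1_t`: add `δ` to the coordinate `t` of `h` when `t ≥ 1`; do nothing for `t = 0`. -/
def addAt (h : ℕ → ℕ) (t δ : ℕ) : ℕ → ℕ := fun r =>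
  if r = t ∧ 1 ≤ t then h r + δ else h r

/-- The induction operator on a single summand:
`Ind_t V^S_h := ⊕_{v ∈ EC(λ)} V^{S +̃ v}_{h + δ^{S,v}·1_t}`. -/
def IndVSh (t n : ℕ) (μ : YoungDiagram) (S : Tab) (h : ℕ → ℕ) :
    Submodule ℚ (MvPolynomial ℕ ℚ) :=
  ⨆ v : ℕ × ℕ, ⨆ _ : IsCorner μ v,
    VSh (n + 1) (insert v μ.cells) (Sadd n S v) (addAt h t (deltaSV n S v))

/-- The extension operator on a single summand:
`Ext V^S_h := ⊕_{v ∈ EC(λ), δ^{S,v} = 1} V^{S +̃ v}_h`. -/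
def ExtVSh (n : ℕ) (μ : YoungDiagram) (S : Tab) (h : ℕ → ℕ) :
    Submodule ℚ (MvPolynomial ℕ ℚ) :=
  ⨆ v : ℕ × ℕ, ⨆ _ : IsCorner μ v ∧ deltaSV n S v = 1,
    VSh (n + 1) (insert v μ.cells) (Sadd n S v) h

/-- `Ind_t R_{n,I}`, applied summand-by-summand to the decomposition of `R_{n,I}`. -/
def IndR (t n : ℕ) (I : Finset ℕ) : Submodule ℚ (MvPolynomial ℕ ℚ) :=
  ⨆ q : SIdx n I, IndVSh t n q.1.1 q.1.2 (hSI n I q.1.2)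

/-- `Ext R_{n,I}`, applied summand-by-summand. -/
def ExtR (n : ℕ) (I : Finset ℕ) : Submodule ℚ (MvPolynomial ℕ ℚ) :=
  ⨆ q : SIdx n I, ExtVSh n q.1.1 q.1.2 (hSI n I q.1.2)

/-- `Ind_t R^hom_{n,I}`, applied summand-by-summand. -/
def IndRhom (t n : ℕ) (I : Finset ℕ) : Submodule ℚ (MvPolynomial ℕ ℚ) :=
  ⨆ q : SIdx n I, IndVSh t n q.1.1 q.1.2 (hInd n I q.1.2)

/-- `Ext R^hom_{n,I}`, applied summand-by-summand. -/
def ExtRhom (n : ℕ) (I : Finset ℕ) : Submodule ℚ (MvPolynomial ℕ ℚ) :=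
  ⨆ q : SIdx n I, ExtVSh n q.1.1 q.1.2 (hInd n I q.1.2)

/-- The lift `R̃_{n,k} = ⊕_{|I| = k-1} R_{n,I}` of the quotient `R_{n,k}`. -/
def Rtil (n k : ℕ) : Submodule ℚ (MvPolynomial ℕ ℚ) :=
  ⨆ I : Finset ℕ, ⨆ _ : I ⊆ Finset.Ioo 0 n ∧ I.card + 1 = k, RnI n I

/-! ### The extended column group -/

/-- The length of column `c` of a tableau. -/
def colLenT (n : ℕ) (T : Tab) (c : ℕ) : ℕ :=
  ((Finset.range (n + 1)).filter fun r => T (r, c) ≠ 0).card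

/-- `q_a`: the number of columns of length `> a` (columns of length `a` occupy the
`0`-indexed columns `q_a, …, q_a + t_a - 1`). -/
def qaT (n : ℕ) (T : Tab) (a : ℕ) : ℕ :=
  ((Finset.range (n + 1)).filter fun c => a < colLenT n T c).card

/-- `t_a`: the number of columns of length `a`. -/
def taT (n : ℕ) (T : Tab) (a : ℕ) : ℕ :=
  ((Finset.range (n + 1)).filter fun c => colLenT n T c = a).card

/-- The function underlying the permutation `η_T`: the entry in row `j` of column `q_a + i`
is sent to the entry in row `j` of column `q_a + η(i)`; everything else is fixed. -/
def etaFun (n : ℕ) (T : Tab) (a : ℕ) (η : Equiv.Perm ℕ) : ℕ → ℕ := fun m =>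
  let c := colIdx T m
  if 1 ≤ m ∧ m ≤ n ∧ qaT n T a ≤ c ∧ c < qaT n T a + taT n T a then
    T (rowIdx T m, qaT n T a + η (c - qaT n T a))
  else m

/-- The set of the permutations `η_T` (over all `a ≥ 1` and all `η ∈ S_{t_a}`). -/
def etaSet (n : ℕ) (T : Tab) : Set (Equiv.Perm ℕ) :=
  {w | ∃ a, 1 ≤ a ∧ ∃ η : Equiv.Perm ℕ, (∀ i, taT n T a ≤ i → η i = i) ∧
    ⇑w = etaFun n T a η}

/-- The subgroup generated by the permutations `η_T` (a copy of `Π_a S_{t_a}`). -/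
def etaSubgroup (n : ℕ) (T : Tab) : Subgroup (Equiv.Perm ℕ) :=
  Subgroup.closure (etaSet n T)

/-- The column group `C(T)` as a subgroup. -/
def colSubgroup (n : ℕ) (T : Tab) : Subgroup (Equiv.Perm ℕ) :=
  Subgroup.closure (colGroupSet n T)

/-- The extended column group `C̃(T)`, generated by `C(T)` and the `η_T`. -/
def extColSubgroup (n : ℕ) (T : Tab) : Subgroup (Equiv.Perm ℕ) :=
  Subgroup.closure (colGroupSet n T ∪ etaSet n T)

/-- The sign of a permutation of `ℕ` supported on `{1, …, n}`. -/
def signOn (n : ℕ) (σ : Equiv.Perm ℕ) : ℤ :=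
  if h : ∃ τ : Equiv.Perm (Fin n), embedPerm n τ = σ then
    (Equiv.Perm.sign h.choose : ℤ) else 0

/-! ### Semistandard tableaux, (generalized) cocharge tableaux -/

/-- A semistandard filling of the given cells: rows weakly increase, columns strictly
increase (entries outside the cells are normalized to `0`). -/
def IsSSYTOn (cells : Finset (ℕ × ℕ)) (C : Tab) : Prop :=
  (∀ c ∉ cells, C c = 0) ∧
  (∀ c₁ ∈ cells, ∀ c₂ ∈ cells, c₁.1 = c₂.1 → c₁.2 ≤ c₂.2 → C c₁ ≤ C c₂) ∧
  (∀ c₁ ∈ cells, ∀ c₂ ∈ cells, c₁.2 = c₂.2 → c₁.1 < c₂.1 → C c₁ < C c₂)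

/-- A generalized cocharge tableau with entries exactly `{0, …, k-1}`. -/
def IsGCT (cells : Finset (ℕ × ℕ)) (C : Tab) (k : ℕ) : Prop :=
  IsSSYTOn cells C ∧ (∀ c ∈ cells, C c < k) ∧ ∀ h < k, ∃ c ∈ cells, C c = h

/-- The type of a generalized cocharge tableau: the set of cumulative multiplicities
`#{c : C c < h}` for `1 ≤ h ≤ k - 1`. -/
def gctType (cells : Finset (ℕ × ℕ)) (C : Tab) (k : ℕ) : Finset ℕ :=
  (Finset.Ico 1 k).image fun h => (cells.filter fun c => C c < h).card

/-- The standardization of a semistandard tableau: entries are replaced by `1, …, n`,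
processing the values in increasing order and, for equal values, from left to right. -/
def stdz (cells : Finset (ℕ × ℕ)) (C : Tab) : Tab := fun c =>
  if c ∈ cells then
    (cells.filter fun c' => C c' < C c ∨
      (C c' = C c ∧ (c'.2 < c.2 ∨ (c'.2 = c.2 ∧ c'.1 ≤ c.1)))).card
  else 0

/-- A cocharge tableau of shape `μ`: one of the form `ct S` for a standard `S`. -/
def IsCCT (μ : YoungDiagram) (C : Tab) : Prop :=
  ∃ S : Tab, IsStandard μ S ∧ ctTab μ.cells.card S = C

/-- `k` for a tableau: one more than the maximal entry. -/
def kOf (cells : Finset (ℕ × ℕ)) (C : Tab) : ℕ := cells.sup C + 1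

/-- `Dsp^c(C) := {n - i : i ∈ J}`, `J` the type of the cocharge tableau `C`. -/
def Dspc (n : ℕ) (cells : Finset (ℕ × ℕ)) (C : Tab) : Finset ℕ :=
  (gctType cells C (kOf cells C)).image fun i => n - i

/-- The entry sum `Σ(C)`. -/
def entrySum (cells : Finset (ℕ × ℕ)) (C : Tab) : ℕ := ∑ c ∈ cells, C c

/-- `C +̂ v := ct (ct⁻¹(C) +̃ v)`, where `ct⁻¹` is the standardization. -/
def Cadd (n : ℕ) (μ : YoungDiagram) (C : Tab) (v : ℕ × ℕ) : Tab :=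
  ctTab (n + 1) (Sadd n (stdz μ.cells C) v)

/-- The standard Young tableau `S⁰` of shape `μ` filling the rows consecutively. -/
def rowWordTab (μ : YoungDiagram) : Tab := fun c =>
  if c ∈ μ.cells then (∑ r ∈ Finset.range c.1, μ.rowLen r) + c.2 + 1 else 0

/-- The word of an ordered set partition: the blocks listed in order, each sorted
increasingly. -/
def opWord (k : ℕ) (B : ℕ → Finset ℕ) : List ℕ :=
  (List.range k).foldr (fun h acc => (B h).sort (· ≤ ·) ++ acc) []

/-- Renaming the variables of a power series along a permutation. -/
def permSeries (g : Equiv.Perm ℕ) (F : MvPowerSeries ℕ ℚ) : MvPowerSeries ℕ ℚ :=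
  fun m => F (Finsupp.mapDomain ⇑g⁻¹ m)


/-! ### Evacuation of a tableau with a new maximal entry at the end of the first row -/

/-- Shift of the first row by one box to the right, on cells. -/
def shC (c : ℕ × ℕ) : ℕ × ℕ := if c.1 = 0 then (0, c.2 + 1) else c

/-- Increment all entries, shift the first row to the right, put `1` in the corner. -/
def shT (S : Tab) : Tab := fun c =>
  if c.1 = 0 then (if c.2 = 0 then 1 else (if S (0, c.2 - 1) = 0 then 0 else S (0, c.2 - 1) + 1))
  else if S c = 0 then 0 else S c + 1

/-- A bijective filling by `1..m` of a lower set whose first row has length `L`. -/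
structure Good (m L : ℕ) (T : Tab) : Prop where
  surj : ∀ v, 1 ≤ v → v ≤ m → ∃ c, T c = v
  le : ∀ c, T c ≤ m
  inj : ∀ c d, T c ≠ 0 → T c = T d → c = d
  low : ∀ a b a' b', T (a, b) ≠ 0 → a' ≤ a → b' ≤ b → T (a', b') ≠ 0
  row : ∀ j, T (0, j) ≠ 0 ↔ j < L

/-- A tableau with a hole at `c` and entries `2..M`. -/
structure Hole (M L : ℕ) (T : Tab) (c : ℕ × ℕ) : Prop where
  zero : T c = 0
  surj : ∀ v, 2 ≤ v → v ≤ M → ∃ d, T d = v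
  le : ∀ d, T d ≤ M
  ne1 : ∀ d, T d ≠ 1
  inj : ∀ d e, T d ≠ 0 → T d = T e → d = e
  low : ∀ a b a' b', (T (a, b) ≠ 0 ∨ (a, b) = c) → a' ≤ a → b' ≤ b →
    (T (a', b') ≠ 0 ∨ (a', b') = c)
  row : ∀ j, (T (0, j) ≠ 0 ∨ (0, j) = c) ↔ j < L

def moveT (T : Tab) (c d : ℕ × ℕ) : Tab := Function.update (Function.update T c (T d)) d 0

theorem moveT_eq {T : Tab} {c d : ℕ × ℕ} (h : T c = 0) (x : ℕ × ℕ) :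
    moveT T c d x = T (Equiv.swap c d x) := by
  unfold moveT
  by_cases hxd : x = d
  · subst hxd; simp [h]
  · by_cases hxc : x = c
    · subst hxc; simp [hxd]
    · simp [hxd, hxc, Equiv.swap_apply_of_ne_of_ne hxc hxd]

theorem Hole.move {M L : ℕ} {T : Tab} {c d : ℕ × ℕ} (h : Hole M L T c) (hd : T d ≠ 0) :
    Hole M L (moveT T c d) d := by
  have hcd : c ≠ d := by rintro rfl; exact hd h.zero
  have key : ∀ x, (moveT T c d x ≠ 0 ∨ x = d) ↔ (T x ≠ 0 ∨ x = c) := by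
    intro x
    rw [moveT_eq h.zero]
    by_cases hxd : x = d
    · subst hxd; simp [hd]
    · by_cases hxc : x = c
      · subst hxc; simp [hd]
      · simp [hxd, hxc, Equiv.swap_apply_of_ne_of_ne hxc hxd]
  refine ⟨?_, ?_, ?_, ?_, ?_, ?_, ?_⟩
  · simp [moveT]
  · intro v h1 h2
    obtain ⟨e, he⟩ := h.surj v h1 h2
    exact ⟨Equiv.swap c d e, by rw [moveT_eq h.zero]; simpa using he⟩
  · intro e; rw [moveT_eq h.zero]; exact h.le _
  · intro e; rw [moveT_eq h.zero]; exact h.ne1 _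
  · intro e f; rw [moveT_eq h.zero, moveT_eq h.zero]
    intro h1 h2
    exact (Equiv.swap c d).injective (h.inj _ _ h1 h2)
  · intro a b a' b' h1 h2 h3
    rw [key] at h1 ⊢
    exact h.low a b a' b' h1 h2 h3
  · intro j; rw [key]; exact h.row j

def meas (M : ℕ) (T : Tab) (c : ℕ × ℕ) : ℕ :=
  ((Finset.Icc 1 M).filter fun v => ∃ d, c ≤ d ∧ T d = v).card

theorem meas_pos {M L : ℕ} {T : Tab} {c d : ℕ × ℕ} (h : Hole M L T c) (hd : T d ≠ 0)
    (hcd : c ≤ d) : 0 < meas M T c := by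
  unfold meas
  refine Finset.card_pos.mpr ⟨T d, ?_⟩
  have := h.le d
  simp only [Finset.mem_filter, Finset.mem_Icc]
  exact ⟨⟨by omega, this⟩, d, hcd, rfl⟩

theorem meas_move {M L : ℕ} {T : Tab} {c d : ℕ × ℕ} (h : Hole M L T c) (hd : T d ≠ 0)
    (hcd : c ≤ d) : meas M (moveT T c d) d < meas M T c := by
  have hne : c ≠ d := by rintro rfl; exact hd h.zero
  unfold meas
  refine Finset.card_lt_card ?_
  rw [Finset.ssubset_iff_of_subset]
  · refine ⟨T d, ?_, ?_⟩
    · have := h.le d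
      simp only [Finset.mem_filter, Finset.mem_Icc]
      exact ⟨⟨by omega, this⟩, d, hcd, rfl⟩
    · simp only [Finset.mem_filter, not_and, not_exists]
      intro _ e hde he
      rw [moveT_eq h.zero] at he
      have := h.inj _ _ hd he.symm
      have h2 : e = c := by
        have := congrArg (Equiv.swap c d) this
        simpa using this.symm
      subst h2
      exact hne (le_antisymm hcd hde)
  · intro v
    simp only [Finset.mem_filter, Finset.mem_Icc]
    rintro ⟨h1, e, hde, he⟩
    refine ⟨h1, e, hcd.trans hde, ?_⟩
    rw [moveT_eq h.zero] at he
    by_cases hed : e = d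
    · subst hed; rw [Equiv.swap_apply_right, h.zero] at he; omega
    · have hec : e ≠ c := by rintro rfl; exact hne (le_antisymm hcd hde)
      rwa [Equiv.swap_apply_of_ne_of_ne hec hed] at he

theorem slide_stop (k : ℕ) {T : Tab} {c : ℕ × ℕ} (h1 : T (c.1, c.2 + 1) = 0)
    (h2 : T (c.1 + 1, c.2) = 0) : slide k T c = (T, c) := by
  cases k with
  | zero => rfl
  | succ k => simp [slide, slideOnce, h1, h2]

theorem slide_right (k : ℕ) {T : Tab} {c : ℕ × ℕ} (h1 : T (c.1, c.2 + 1) ≠ 0)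
    (h2 : T (c.1 + 1, c.2) = 0 ∨ T (c.1, c.2 + 1) < T (c.1 + 1, c.2)) :
    slide (k + 1) T c = slide k (moveT T c (c.1, c.2 + 1)) (c.1, c.2 + 1) := by
  have hne : (c.1, c.2 + 1) ≠ c := by
    intro h; have := congrArg Prod.snd h; simp at this
  have h3 : T (c.1 + 1, c.2) = 0 ∨ (T (c.1, c.2 + 1) ≠ 0 ∧ T (c.1, c.2 + 1) < T (c.1 + 1, c.2)) := by
    tauto
  have : slideOnce T c = (moveT T c (c.1, c.2 + 1), (c.1, c.2 + 1)) := by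
    simp only [slideOnce]
    rw [if_neg (fun h => h1 h.1), if_pos h3]
    rfl
  simp only [slide, this]
  rw [if_neg hne]

theorem slide_down (k : ℕ) {T : Tab} {c : ℕ × ℕ} (h1 : T (c.1 + 1, c.2) ≠ 0)
    (h2 : T (c.1, c.2 + 1) = 0 ∨ ¬ T (c.1, c.2 + 1) < T (c.1 + 1, c.2)) :
    slide (k + 1) T c = slide k (moveT T c (c.1 + 1, c.2)) (c.1 + 1, c.2) := by
  have hne : (c.1 + 1, c.2) ≠ c := by
    intro h; have := congrArg Prod.fst h; simp at this
  have h3 : ¬ (T (c.1 + 1, c.2) = 0 ∨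
      (T (c.1, c.2 + 1) ≠ 0 ∧ T (c.1, c.2 + 1) < T (c.1 + 1, c.2))) := by
    tauto
  have : slideOnce T c = (moveT T c (c.1 + 1, c.2), (c.1 + 1, c.2)) := by
    simp only [slideOnce]
    rw [if_neg (fun h => h1 h.2), if_neg h3]
    rfl
  simp only [slide, this]
  rw [if_neg hne]

theorem moveT_update {T : Tab} {c d e : ℕ × ℕ} {v : ℕ} (hc : c ≠ e) (hd : d ≠ e) :
    moveT (Function.update T e v) c d = Function.update (moveT T c d) e v := by
  unfold moveT
  rw [Function.update_of_ne hd, Function.update_comm hc.symm, Function.update_comm hd.symm]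

def SlideSpec (M k L : ℕ) (T : Tab) (c : ℕ × ℕ) : Prop :=
    Hole M L (slide k T c).1 (slide k T c).2 ∧
    (slide k T c).1 ((slide k T c).2.1, (slide k T c).2.2 + 1) = 0 ∧
    (slide k T c).1 ((slide k T c).2.1 + 1, (slide k T c).2.2) = 0 ∧
    slide (k + 1) (Function.update T (0, L) (M + 1)) c =
      (Function.update (slide k T c).1 (0, if (slide k T c).2.1 = 0 then L - 1 else L) (M + 1),
        shC (slide k T c).2)

theorem slide_spec_stop {M L : ℕ} (k : ℕ) {T : Tab} {c : ℕ × ℕ} (h : Hole M L T c)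
    (h1 : T (c.1, c.2 + 1) = 0) (h2 : T (c.1 + 1, c.2) = 0) :
    SlideSpec M k L T c := by
  unfold SlideSpec
  rw [slide_stop k h1 h2]
  refine ⟨h, h1, h2, ?_⟩
  obtain ⟨a, b⟩ := c
  simp only at h1 h2 ⊢
  by_cases ha : a = 0
  · subst ha
    have hb : b < L := (h.row b).1 (Or.inr rfl)
    have hb2 : ¬ b + 1 < L := by
      rw [← h.row]; simp [h1]
    obtain rfl : L = b + 1 := by omega
    have h3 : T (1, b + 1) = 0 := by
      by_contra h3
      have := h.low 1 (b + 1) 0 (b + 1) (Or.inl h3) (by omega) le_rfl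
      rw [h.row] at this
      omega
    have h4 : T (0, b + 2) = 0 := by
      by_contra h4
      have := (h.row (b + 2)).1 (Or.inl h4)
      omega
    rw [slide_right k (by simp) (by simp [h2])]
    have hm : moveT (Function.update T (0, b + 1) (M + 1)) (0, b) (0, b + 1) =
        Function.update T (0, b) (M + 1) := by
      unfold moveT
      funext x
      by_cases hx : x = (0, b + 1)
      · subst hx; simp [h1]
      · by_cases hx' : x = (0, b)
        · subst hx'; simp
        · simp [hx, hx']
    rw [hm, slide_stop]
    · simp [shC]
    · rw [Function.update_of_ne (by simp; omega)]; exact h4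
    · simp [h3]
  · rw [slide_stop]
    · simp [ha, shC]
    · simp [ha, h1]
    · simp [h2]

theorem slide_spec (M : ℕ) : ∀ (k L : ℕ) (T : Tab) (c : ℕ × ℕ), Hole M L T c → meas M T c ≤ k →
    SlideSpec M k L T c := by
  intro k
  induction k with
  | zero =>
    intro L T c h hm
    have h1 : T (c.1, c.2 + 1) = 0 := by
      by_contra h'
      have := meas_pos h h' (by constructor <;> simp)
      omega
    have h2 : T (c.1 + 1, c.2) = 0 := by
      by_contra h'
      have := meas_pos h h' (by constructor <;> simp)
      omega
    exact slide_spec_stop 0 h h1 h2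
  | succ k ih =>
    intro L T c h hm
    have hrow : ∀ e, (T e ≠ 0 ∨ e = c) → e ≠ (0, L) := by
      rintro e he rfl
      have := (h.row L).1 he
      omega
    have hc := hrow c (Or.inr rfl)
    have hdn : T (c.1 + 1, c.2) = Function.update T (0, L) (M + 1) (c.1 + 1, c.2) := by
      simp
    have down : T (c.1 + 1, c.2) ≠ 0 →
        (T (c.1, c.2 + 1) = 0 ∨ ¬ T (c.1, c.2 + 1) < T (c.1 + 1, c.2)) → SlideSpec M (k + 1) L T c := by
      intro h1 h2
      have hs := slide_down k h1 h2
      have hs' : slide (k + 1 + 1) (Function.update T (0, L) (M + 1)) c = _ :=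
        slide_down (k + 1) (by rwa [← hdn]) (by
          rw [← hdn]
          by_cases hr : (c.1, c.2 + 1) = (0, L)
          · right; rw [hr]; have := h.le (c.1 + 1, c.2); simp; omega
          · rw [Function.update_of_ne hr]; exact h2)
      rw [moveT_update hc (hrow _ (Or.inl h1))] at hs'
      have hle : c ≤ (c.1 + 1, c.2) := by constructor <;> simp
      have := ih L _ _ (h.move h1) (by have := meas_move h h1 hle; omega)
      unfold SlideSpec at this ⊢
      rw [← hs, ← hs'] at this
      exact this
    by_cases h1 : T (c.1, c.2 + 1) = 0
    · by_cases h2 : T (c.1 + 1, c.2) = 0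
      · exact slide_spec_stop _ h h1 h2
      · exact down h2 (Or.inl h1)
    · by_cases h2 : T (c.1 + 1, c.2) = 0 ∨ T (c.1, c.2 + 1) < T (c.1 + 1, c.2)
      · have hrt := hrow _ (Or.inl h1)
        have hs := slide_right k h1 h2
        have hs' : slide (k + 1 + 1) (Function.update T (0, L) (M + 1)) c = _ :=
          slide_right (k + 1) (by rwa [Function.update_of_ne hrt]) (by
            rw [← hdn, Function.update_of_ne hrt]; exact h2)
        rw [moveT_update hc hrt] at hs'
        have hle : c ≤ (c.1, c.2 + 1) := by constructor <;> simp
        have := ih L _ _ (h.move h1) (by have := meas_move h h1 hle; omega)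
        unfold SlideSpec at this ⊢
        rw [← hs, ← hs'] at this
        exact this
      · push Not at h2
        exact down h2.1 (Or.inr (by omega))

theorem Hole.good {M L : ℕ} {T : Tab} {c : ℕ × ℕ} (h : Hole (M + 1) L T c)
    (h1 : T (c.1, c.2 + 1) = 0) (h2 : T (c.1 + 1, c.2) = 0) :
    Good M (if c.1 = 0 then L - 1 else L) (fun d => T d - 1) := by
  have hnz : ∀ d, T d - 1 ≠ 0 ↔ T d ≠ 0 := fun d => by have := h.ne1 d; omega
  have low : ∀ a b a' b', T (a, b) ≠ 0 → a' ≤ a → b' ≤ b → T (a', b') ≠ 0 := by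
    intro a b a' b' hab ha hb
    rcases h.low a b a' b' (Or.inl hab) ha hb with h' | h'
    · exact h'
    · exfalso
      subst h'
      simp only at h1 h2
      by_cases hb' : b' = b
      · subst hb'
        have hlt : a' + 1 ≤ a := by
          by_contra hlt
          obtain rfl : a' = a := by omega
          exact hab h.zero
        rcases h.low a b' (a' + 1) b' (Or.inl hab) hlt le_rfl with h'' | h''
        · exact h'' h2
        · simp at h''
      · rcases h.low a b a' (b' + 1) (Or.inl hab) ha (by omega) with h'' | h''
        · exact h'' h1
        · simp at h''
  refine ⟨?_, ?_, ?_, ?_, ?_⟩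
  · intro v hv1 hv2
    obtain ⟨d, hd⟩ := h.surj (v + 1) (by omega) (by omega)
    exact ⟨d, by simp [hd]⟩
  · intro d; have := h.le d; omega
  · intro d e hd hde
    have h3 := (hnz d).1 hd
    have h4 := (hnz e).1 (by rwa [← hde])
    exact h.inj d e h3 (by omega)
  · intro a b a' b' hab ha hb
    rw [hnz] at hab ⊢
    exact low a b a' b' hab ha hb
  · intro j
    rw [hnz]
    obtain ⟨a, b⟩ := c
    by_cases ha : a = 0
    · subst ha
      simp only [if_true]
      have hb : b < L := (h.row b).1 (Or.inr rfl)
      have hb2 : ¬ b + 1 < L := by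
        rw [← h.row]; simp at h1; simp [h1]
      have hj := h.row j
      obtain rfl : L = b + 1 := by omega
      constructor
      · intro hT
        have h5 := hj.1 (Or.inl hT)
        have : j ≠ b := by rintro rfl; exact hT h.zero
        omega
      · intro hlt
        rcases hj.2 (by omega) with h6 | h6
        · exact h6
        · simp at h6; omega
    · simp only [ha, if_false]
      have hj := h.row j
      have : ((0, j) : ℕ × ℕ) ≠ (a, b) := by simp; omega
      tauto

theorem posOf_spec {T : Tab} {i : ℕ} (h : ∃ c, T c = i) : T (posOf T i) = i := by
  obtain ⟨⟨a, b⟩, hab⟩ := h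
  have h1 : ∃ c, T (rowIdx T i, c) = i := Nat.sInf_mem (s := {r | ∃ c, T (r, c) = i}) ⟨a, b, hab⟩
  exact Nat.sInf_mem (s := {c | T (rowIdx T i, c) = i}) h1

theorem posOf_congr {T T' : Tab} {i : ℕ} (h : ∀ c, T c = i ↔ T' c = i) :
    posOf T i = posOf T' i := by
  simp only [posOf, rowIdx, colIdx, h]

theorem Good.hole {M L : ℕ} {T : Tab} (h : Good (M + 1) L T) :
    Hole (M + 1) L (Function.update T (posOf T 1) 0) (posOf T 1) ∧ T (posOf T 1) = 1 := by
  have h1 : T (posOf T 1) = 1 := posOf_spec (h.surj 1 le_rfl (by omega))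
  refine ⟨?_, h1⟩
  generalize posOf T 1 = c at h1
  have key : ∀ x, (Function.update T c 0 x ≠ 0 ∨ x = c) ↔ T x ≠ 0 := by
    intro x
    by_cases hx : x = c
    · subst hx; simp [h1]
    · simp [hx]
  refine ⟨by simp, ?_, ?_, ?_, ?_, ?_, ?_⟩
  · intro v h2 h3
    obtain ⟨d, hd⟩ := h.surj v (by omega) h3
    refine ⟨d, ?_⟩
    rw [Function.update_of_ne, hd]
    rintro rfl; omega
  · intro d
    have := h.le d
    by_cases hx : d = c
    · subst hx; simp
    · simpa [hx] using this
  · intro d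
    by_cases hx : d = c
    · subst hx; simp
    · rw [Function.update_of_ne hx]
      intro h2
      exact hx (h.inj d c (by omega) (by omega))
  · intro d e
    by_cases hx : d = c
    · subst hx; simp
    · by_cases hy : e = c
      · subst hy; simp; tauto
      · rw [Function.update_of_ne hx, Function.update_of_ne hy]; exact h.inj d e
  · intro a b a' b'
    rw [key, key]; exact h.low a b a' b'
  · intro j; rw [key]; exact h.row j

theorem meas_le (M : ℕ) (T : Tab) (c : ℕ × ℕ) : meas M T c ≤ M := by
  unfold meas
  refine (Finset.card_filter_le _ _).trans ?_
  simp

theorem evacAux_succ (m : ℕ) (T : Tab) : evacAux (m + 1) T =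
    Function.update (evacAux m fun c =>
      (slide (m + 1) (Function.update T (posOf T 1) 0) (posOf T 1)).1 c - 1)
      (slide (m + 1) (Function.update T (posOf T 1) 0) (posOf T 1)).2 (m + 1) := rfl

theorem shT_update (S : Tab) (c : ℕ × ℕ) (v : ℕ) (hv : v ≠ 0) :
    shT (Function.update S c v) = Function.update (shT S) (shC c) (v + 1) := by
  funext ⟨a, b⟩
  obtain ⟨c, d⟩ := c
  unfold shT shC
  by_cases ha : a = 0
  · subst ha
    by_cases hc : c = 0
    · subst hc
      rcases b with _ | b
      · simp
      · by_cases hb : b = d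
        · subst hb; simp [hv]
        · simp [hb]
    · simp [hc, Ne.symm hc]
  · by_cases hc : c = 0
    · subst hc; simp [ha]
    · by_cases h : (a, b) = (c, d)
      · simp only [Prod.mk.injEq] at h
        obtain ⟨rfl, rfl⟩ := h
        simp [ha, hv]
      · simp [ha, hc, Function.update_of_ne h]

theorem evac_add : ∀ (m L : ℕ) (T : Tab), Good m L T →
    evacAux (m + 1) (Function.update T (0, L) (m + 1)) = shT (evacAux m T) := by
  intro m
  induction m with
  | zero =>
    intro L T h
    have hT : T = fun _ => 0 := by
      funext c; have := h.le c; omega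
    have hL : L = 0 := by
      by_contra hL
      have := (h.row 0).2 (by omega)
      exact this (by simp [hT])
    subst hL
    have hp : posOf (Function.update T (0, 0) (0 + 1)) 1 = (0, 0) := by
      have := posOf_spec (T := Function.update T (0, 0) (0 + 1)) (i := 1) ⟨(0, 0), by simp⟩
      by_contra hne
      rw [Function.update_of_ne hne, hT] at this
      simp at this
    rw [evacAux_succ, hp, slide_stop]
    · funext ⟨a, b⟩
      simp only [evacAux, shT, Function.update_apply, Prod.mk.injEq]
      by_cases ha : a = 0 <;> by_cases hb : b = 0 <;> simp [ha, hb]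
    · simp [hT]
    · simp [hT]
  | succ m ih =>
    intro L T h
    have h0 : T (0, L) = 0 := by
      by_contra h0
      have := (h.row L).1 h0
      omega
    have hp : posOf (Function.update T (0, L) (m + 1 + 1)) 1 = posOf T 1 := by
      apply posOf_congr
      intro c
      by_cases hc : c = (0, L)
      · subst hc; simp [h0]
      · simp [hc]
    obtain ⟨hh, h1⟩ := h.hole
    have hne : posOf T 1 ≠ (0, L) := by
      intro h'; rw [h', h0] at h1; omega
    obtain ⟨s1, s2, s3, s4⟩ := slide_spec (m + 1) (m + 1) L _ _ hh (meas_le _ _ _)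
    rw [evacAux_succ (m + 1), evacAux_succ m T, hp, Function.update_comm hne.symm, s4]
    generalize slide (m + 1) (Function.update T (posOf T 1) 0) (posOf T 1) = p at *
    rw [shT_update _ _ _ (by omega), ← ih _ _ (s1.good s2 s3)]
    congr 2
    funext c
    simp only [Function.update_apply]
    split_ifs <;> rfl

theorem evac_corner : ∀ (m L : ℕ) (T : Tab), Good (m + 1) L T →
    evacAux (m + 1) T (0, 0) = 1 := by
  intro m
  induction m with
  | zero =>
    intro L T h
    obtain ⟨hh, h1⟩ := h.hole
    have h00 : T (0, 0) ≠ 0 :=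
      h.low (posOf T 1).1 (posOf T 1).2 0 0 (by simp [h1]) (by omega) (by omega)
    have hp : posOf T 1 = (0, 0) := by
      apply h.inj _ _ (by omega)
      have := h.le (0, 0)
      omega
    have hz : ∀ c, c ≠ (0, 0) → T c = 0 := by
      intro c hc
      by_contra h'
      apply hc
      apply h.inj _ _ h'
      have := h.le (0, 0)
      have := h.le c
      omega
    rw [evacAux_succ, hp, slide_stop]
    · simp
    · simpa using hz (0, 1) (by simp)
    · simpa using hz (1, 0) (by simp)
  | succ m ih =>
    intro L T h
    obtain ⟨hh, h1⟩ := h.hole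
    obtain ⟨s1, s2, s3, s4⟩ := slide_spec (m + 2) (m + 2) L _ _ hh (meas_le _ _ _)
    rw [evacAux_succ (m + 1)]
    have hg := s1.good s2 s3
    rw [Function.update_of_ne, ih _ _ hg]
    intro h0
    obtain ⟨c, hc⟩ := hg.surj 1 (by omega) (by omega)
    have h2 := hg.low c.1 c.2 0 0 (by simp [hc]) (by omega) (by omega)
    have h3 := s1.zero
    rw [← h0] at h3
    omega

/-! ### Robinson–Schensted facts -/

def Rel : List ℕ → List ℕ → Prop
  | _, [] => True
  | [], _ :: _ => False
  | a :: r, b :: s => a < b ∧ Rel r s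

theorem Rel_nil (r : List ℕ) : Rel r [] := by cases r <;> trivial

theorem Rel.length_le : ∀ {r s : List ℕ}, Rel r s → s.length ≤ r.length
  | _, [], _ => by simp
  | [], _ :: _, h => h.elim
  | a :: r, b :: s, h => by have := Rel.length_le h.2; simpa using this

theorem rowInsert_cons_lt {x y : ℕ} (ys : List ℕ) (h : x < y) :
    rowInsert x (y :: ys) = (x :: ys, some y) := by
  simp [rowInsert, h]

theorem rowInsert_cons_not {x y : ℕ} (ys : List ℕ) (h : ¬ x < y) :
    rowInsert x (y :: ys) = (y :: (rowInsert x ys).1, (rowInsert x ys).2) := by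
  simp [rowInsert, h]

theorem rowInsert_some_lt {x y : ℕ} : ∀ {r : List ℕ}, (rowInsert x r).2 = some y → x < y
  | [], h => by simp [rowInsert] at h
  | z :: zs, h => by
    by_cases hz : x < z
    · rw [rowInsert_cons_lt _ hz] at h; simp at h; omega
    · rw [rowInsert_cons_not _ hz] at h; exact rowInsert_some_lt h

theorem Rel.mono {x : ℕ} : ∀ {r s : List ℕ}, Rel r s → Rel (rowInsert x r).1 s
  | _, [], _ => Rel_nil _
  | [], _ :: _, h => h.elim
  | a :: r, b :: s, h => by
    by_cases hz : x < a
    · rw [rowInsert_cons_lt _ hz]; exact ⟨hz.trans h.1, h.2⟩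
    · rw [rowInsert_cons_not _ hz]; exact ⟨h.1, h.2.mono⟩

theorem Rel.bump {x y : ℕ} : ∀ {r s : List ℕ}, Rel r s → (rowInsert x r).2 = some y →
    Rel (rowInsert x r).1 (rowInsert y s).1
  | [], s, h, h1 => by simp [rowInsert] at h1
  | a :: r, [], h, h1 => by
    have hxy := rowInsert_some_lt h1
    by_cases hz : x < a
    · rw [rowInsert_cons_lt _ hz]; exact ⟨hxy, Rel_nil _⟩
    · rw [rowInsert_cons_not _ hz]; exact ⟨by omega, Rel_nil _⟩
  | a :: r, b :: s, h, h1 => by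
    have hxy := rowInsert_some_lt h1
    by_cases hz : x < a
    · rw [rowInsert_cons_lt _ hz] at h1 ⊢
      simp at h1; subst h1
      rw [rowInsert_cons_lt _ h.1]
      exact ⟨hz, h.2⟩
    · rw [rowInsert_cons_not _ hz] at h1 ⊢
      by_cases hy : y < b
      · rw [rowInsert_cons_lt _ hy]; exact ⟨by omega, h.2.mono⟩
      · rw [rowInsert_cons_not _ hy]; exact ⟨h.1, Rel.bump h.2 h1⟩

theorem tabInsert_none {x : ℕ} {r : List ℕ} (rs : List (List ℕ)) (h : (rowInsert x r).2 = none) :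
    tabInsert (r :: rs) x = (rowInsert x r).1 :: rs := by
  rw [tabInsert]
  rcases hp : rowInsert x r with ⟨r', _ | y⟩
  · rfl
  · rw [hp] at h; simp at h

theorem tabInsert_some {x y : ℕ} {r : List ℕ} (rs : List (List ℕ))
    (h : (rowInsert x r).2 = some y) :
    tabInsert (r :: rs) x = (rowInsert x r).1 :: tabInsert rs y := by
  rw [tabInsert]
  rcases hp : rowInsert x r with ⟨r', _ | z⟩
  · rw [hp] at h; simp at h
  · rw [hp] at h; simp at h; subst h; rfl

theorem tabInsert_cons_head (x : ℕ) (r : List ℕ) (rs : List (List ℕ)) :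
    ∃ ts, tabInsert (r :: rs) x = (rowInsert x r).1 :: ts := by
  rcases h : (rowInsert x r).2 with _ | y
  · exact ⟨_, tabInsert_none rs h⟩
  · exact ⟨_, tabInsert_some rs h⟩

theorem chain_tabInsert : ∀ (t : List (List ℕ)) (x : ℕ), t.IsChain Rel →
    (tabInsert t x).IsChain Rel
  | [], x, _ => by simp [tabInsert]
  | r :: rs, x, h => by
    rcases hp : (rowInsert x r).2 with _ | y
    · rw [tabInsert_none rs hp]
      cases rs with
      | nil => simp
      | cons r1 rs =>
        rw [List.isChain_cons_cons] at h ⊢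
        exact ⟨h.1.mono, h.2⟩
    · rw [tabInsert_some rs hp]
      cases rs with
      | nil =>
        simp only [tabInsert, List.isChain_cons_cons, List.isChain_singleton, and_true]
        exact Rel.bump (s := []) (Rel_nil r) hp
      | cons r1 rs =>
        rw [List.isChain_cons_cons] at h
        have ih := chain_tabInsert (r1 :: rs) y h.2
        obtain ⟨ts, hts⟩ := tabInsert_cons_head y r1 rs
        rw [hts] at ih ⊢
        rw [List.isChain_cons_cons]
        exact ⟨Rel.bump h.1 hp, ih⟩

/-- Row lengths. -/
def rl (t : List (List ℕ)) (r : ℕ) : ℕ := (t.getD r []).length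

theorem rl_cons_zero (r : List ℕ) (t) : rl (r :: t) 0 = r.length := by simp [rl]
theorem rl_cons_succ (r : List ℕ) (t) (k : ℕ) : rl (r :: t) (k + 1) = rl t k := by simp [rl]
theorem rl_nil (k : ℕ) : rl [] k = 0 := by simp [rl]

theorem rl_anti_step : ∀ (t : List (List ℕ)), t.IsChain Rel → ∀ k, rl t (k + 1) ≤ rl t k
  | [], _, k => by simp [rl_nil]
  | [r], _, k => by simp [rl_cons_succ, rl_nil]
  | r :: s :: t, h, k => by
    rw [List.isChain_cons_cons] at h
    cases k with
    | zero => simpa [rl_cons_succ, rl_cons_zero] using h.1.length_le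
    | succ k => 
      rw [rl_cons_succ, rl_cons_succ r]
      exact rl_anti_step (s :: t) h.2 k

theorem rowInsert_length {x : ℕ} : ∀ (r : List ℕ),
    (rowInsert x r).1.length = r.length + if (rowInsert x r).2 = none then 1 else 0
  | [] => by simp [rowInsert]
  | a :: r => by
    by_cases hz : x < a
    · rw [rowInsert_cons_lt _ hz]; simp
    · rw [rowInsert_cons_not _ hz]
      have := rowInsert_length (x := x) r
      simp only [List.length_cons]
      omega

theorem rl_tabInsert : ∀ (t : List (List ℕ)) (x : ℕ),
    ∃ k, ∀ j, rl (tabInsert t x) j = rl t j + if j = k then 1 else 0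
  | [], x => ⟨0, fun j => by cases j <;> simp [tabInsert, rl]⟩
  | r :: rs, x => by
    have hl := rowInsert_length (x := x) r
    rcases hp : (rowInsert x r).2 with _ | y
    · refine ⟨0, fun j => ?_⟩
      rw [tabInsert_none rs hp]
      simp only [hp, if_true] at hl
      cases j with
      | zero => simp [rl_cons_zero, hl]
      | succ j => simp [rl_cons_succ]
    · obtain ⟨k, hk⟩ := rl_tabInsert rs y
      refine ⟨k + 1, fun j => ?_⟩
      rw [tabInsert_some rs hp]
      simp [hp] at hl
      cases j with
      | zero => simp [rl_cons_zero, hl]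
      | succ j => simp [rl_cons_succ, hk]

theorem rowInsert_perm {x : ℕ} : ∀ (r : List ℕ),
    ((rowInsert x r).1 ++ (rowInsert x r).2.toList).Perm (x :: r)
  | [] => by simp [rowInsert]
  | a :: r => by
    by_cases hz : x < a
    · rw [rowInsert_cons_lt _ hz]
      simpa using (List.perm_append_singleton a r)
    · rw [rowInsert_cons_not _ hz]
      exact ((rowInsert_perm r).cons a).trans (List.Perm.swap _ _ _)

theorem tabInsert_perm : ∀ (t : List (List ℕ)) (x : ℕ),
    (tabInsert t x).flatten.Perm (x :: t.flatten)
  | [], x => by simp [tabInsert]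
  | r :: rs, x => by
    have hl := rowInsert_perm (x := x) r
    rcases hp : (rowInsert x r).2 with _ | y
    · rw [tabInsert_none rs hp]
      rw [hp] at hl
      simp at hl
      simpa using hl.append_right rs.flatten
    · rw [tabInsert_some rs hp]
      rw [hp] at hl
      have ih := tabInsert_perm rs y
      have h1 : ((rowInsert x r).1 ++ (tabInsert rs y).flatten).Perm
          ((rowInsert x r).1 ++ (y :: rs.flatten)) := ih.append_left _
      have h2 := hl.append_right rs.flatten
      simp at h2
      simpa using h1.trans h2

/-- Insertion tableau of `w 1, …, w m`. -/
def WT (w : Equiv.Perm ℕ) : ℕ → List (List ℕ)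
  | 0 => []
  | m + 1 => tabInsert (WT w m) (w (m + 1))

theorem foldl_WT (w : Equiv.Perm ℕ) (m : ℕ) :
    ((List.range m).map fun i => w (i + 1)).foldl tabInsert [] = WT w m := by
  induction m with
  | zero => rfl
  | succ m ih => rw [List.range_succ, List.map_append, List.foldl_append, ih]; rfl

theorem PLP_eq (n : ℕ) (w : Equiv.Perm ℕ) (m : ℕ) : PtabListPart n w m = WT w (min m n) := by
  rw [PtabListPart, oneLine, ← List.map_take, List.take_range, foldl_WT]

theorem WT_chain (w : Equiv.Perm ℕ) (m : ℕ) : (WT w m).IsChain Rel := by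
  induction m with
  | zero => simp [WT]
  | succ m ih => exact chain_tabInsert _ _ ih

theorem WT_perm (w : Equiv.Perm ℕ) (m : ℕ) :
    (WT w m).flatten.Perm ((List.range m).map fun i => w (i + 1)) := by
  induction m with
  | zero => simp [WT]
  | succ m ih =>
    refine (tabInsert_perm _ _).trans ?_
    rw [List.range_succ, List.map_append]
    refine (ih.cons _).trans ?_
    simpa using (List.perm_append_singleton (w (m + 1)) _).symm

theorem WT_nodup (w : Equiv.Perm ℕ) (m : ℕ) : (WT w m).flatten.Nodup := by
  rw [(WT_perm w m).nodup_iff]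
  refine List.Nodup.map ?_ List.nodup_range
  intro a b h
  have := w.injective h
  omega

theorem WT_mem (w : Equiv.Perm ℕ) (m v : ℕ) :
    v ∈ (WT w m).flatten ↔ ∃ i < m, w (i + 1) = v := by
  rw [(WT_perm w m).mem_iff]; simp

theorem rl_anti (w : Equiv.Perm ℕ) (m : ℕ) : Antitone (rl (WT w m)) :=
  antitone_nat_of_succ_le (rl_anti_step _ (WT_chain w m))

theorem entry_mem {t : List (List ℕ)} {a b : ℕ} (h : b < rl t a) :
    ∃ r ∈ t, listEntry t (a, b) ∈ r ∧ t[a]? = some r ∧ r[b]? = some (listEntry t (a, b)) := by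
  unfold rl at h
  have ha : a < t.length := by
    by_contra ha
    rw [List.getD_eq_default _ _ (by omega)] at h
    simp at h
  rw [List.getD_eq_getElem _ _ ha] at h
  refine ⟨t[a], List.getElem_mem ha, ?_, by simp [ha], ?_⟩
  · unfold listEntry
    simp only
    rw [List.getD_eq_getElem _ _ ha, List.getD_eq_getElem _ _ h]
    exact List.getElem_mem h
  · unfold listEntry
    simp only
    rw [List.getD_eq_getElem _ _ ha, List.getD_eq_getElem _ _ h]
    simp [h]

theorem entry_zero {t : List (List ℕ)} {a b : ℕ} (h : ¬ b < rl t a) :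
    listEntry t (a, b) = 0 := by
  unfold rl at h
  unfold listEntry
  simp only
  rw [List.getD_eq_default _ _ (by omega)]

theorem WT_pos (w : Equiv.Perm ℕ) (m : ℕ) (h0 : w 0 = 0) : 0 ∉ (WT w m).flatten := by
  rw [WT_mem]
  rintro ⟨i, _, hi⟩
  have := w.injective (hi.trans h0.symm)
  omega

theorem entry_ne_zero (w : Equiv.Perm ℕ) (m : ℕ) (h0 : w 0 = 0) (a b : ℕ) :
    listEntry (WT w m) (a, b) ≠ 0 ↔ b < rl (WT w m) a := by
  constructor
  · intro h; by_contra h'; exact h (entry_zero h')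
  · intro h h1
    obtain ⟨r, hr, hm, _⟩ := entry_mem h
    rw [h1] at hm
    exact WT_pos w m h0 (List.mem_flatten.2 ⟨r, hr, hm⟩)

theorem perm_range {n : ℕ} {w : Equiv.Perm ℕ} (hw : SuppIn n w) (v : ℕ) :
    (∃ i < n, w (i + 1) = v) ↔ 1 ≤ v ∧ v ≤ n := by
  have h0 : w 0 = 0 := hw 0 (Or.inl rfl)
  constructor
  · rintro ⟨i, hi, rfl⟩
    constructor
    · by_contra h
      have h1 : w (i + 1) = w 0 := by omega
      have := w.injective h1
      omega
    · by_contra h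
      have h1 := hw _ (Or.inr (not_le.1 h))
      have := w.injective h1
      omega
  · rintro ⟨h1, h2⟩
    refine ⟨w.symm v - 1, ?_, ?_⟩
    · have : w.symm v ≠ 0 := by
        intro h; rw [Equiv.symm_apply_eq] at h; omega
      have : w.symm v ≤ n := by
        by_contra h
        have := hw _ (Or.inr (not_le.1 h))
        rw [Equiv.apply_symm_apply] at this
        omega
      omega
    · have : w.symm v ≠ 0 := by
        intro h; rw [Equiv.symm_apply_eq] at h; omega
      rw [Nat.sub_add_cancel (by omega), Equiv.apply_symm_apply]

theorem Ptab_eq (n : ℕ) (w : Equiv.Perm ℕ) : Ptab n w = listEntry (WT w n) := by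
  funext c; rw [Ptab, PLP_eq, min_self]

theorem good_P {n : ℕ} {w : Equiv.Perm ℕ} (hw : SuppIn n w) :
    Good n (rl (WT w n) 0) (Ptab n w) := by
  have h0 : w 0 = 0 := hw 0 (Or.inl rfl)
  have hmem : ∀ v, v ∈ (WT w n).flatten ↔ 1 ≤ v ∧ v ≤ n := fun v => by
    rw [WT_mem, perm_range hw]
  rw [Ptab_eq]
  refine ⟨?_, ?_, ?_, ?_, ?_⟩
  · intro v h1 h2
    obtain ⟨r, hr, hv⟩ := List.mem_flatten.1 ((hmem v).2 ⟨h1, h2⟩)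
    obtain ⟨a, ha, rfl⟩ := List.mem_iff_getElem.1 hr
    obtain ⟨b, hb, rfl⟩ := List.mem_iff_getElem.1 hv
    refine ⟨(a, b), ?_⟩
    unfold listEntry
    simp only
    rw [List.getD_eq_getElem _ _ ha, List.getD_eq_getElem _ _ hb]
  · rintro ⟨a, b⟩
    by_cases h : b < rl (WT w n) a
    · obtain ⟨r, hr, hm, _⟩ := entry_mem h
      exact ((hmem _).1 (List.mem_flatten.2 ⟨r, hr, hm⟩)).2
    · rw [entry_zero h]; omega
  · rintro ⟨a, b⟩ ⟨a', b'⟩ h he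
    have h' := h
    rw [he] at h'
    rw [entry_ne_zero w n h0] at h h'
    obtain ⟨r, hr, hm, e1, e2⟩ := entry_mem h
    obtain ⟨r', hr', hm', e1', e2'⟩ := entry_mem h'
    have hn := WT_nodup w n
    rw [List.nodup_flatten] at hn
    have haa : a = a' := by
      by_contra hne
      obtain ⟨ha, e3⟩ := List.getElem?_eq_some_iff.1 e1
      obtain ⟨ha', e3'⟩ := List.getElem?_eq_some_iff.1 e1'
      rw [he] at hm
      have hd := List.pairwise_iff_getElem.1 hn.2
      rcases lt_or_gt_of_ne hne with hlt | hlt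
      · have := hd a a' ha ha' hlt
        rw [e3, e3'] at this
        exact this hm hm'
      · have := hd a' a ha' ha hlt
        rw [e3, e3'] at this
        exact this hm' hm
    subst haa
    have hrr : r = r' := by rw [e1] at e1'; simpa using e1'
    subst hrr
    have hnr := hn.1 r hr
    obtain ⟨hb, e4⟩ := List.getElem?_eq_some_iff.1 e2
    obtain ⟨hb', e4'⟩ := List.getElem?_eq_some_iff.1 e2'
    have : b = b' := (hnr.getElem_inj_iff (hi := hb) (hj := hb')).1 (by rw [e4, e4', he])
    rw [this]
  · intro a b a' b' h ha hb
    rw [entry_ne_zero w n h0] at h ⊢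
    have := rl_anti w n ha
    omega
  · intro j; rw [entry_ne_zero w n h0]

theorem rowInsert_big {x : ℕ} : ∀ {r : List ℕ}, (∀ y ∈ r, y < x) → rowInsert x r = (r ++ [x], none)
  | [], _ => rfl
  | a :: r, h => by
    have ha : a < x := h a (by simp)
    rw [rowInsert_cons_not _ (by omega), rowInsert_big (fun y hy => h y (by simp [hy]))]
    rfl

theorem tabInsert_big {x : ℕ} {t : List (List ℕ)} (h : ∀ y ∈ t.flatten, y < x) :
    listEntry (tabInsert t x) = Function.update (listEntry t) (0, rl t 0) x := by
  have key : ∀ r : List ℕ, ∀ b, (r ++ [x]).getD b 0 = if b = r.length then x else r.getD b 0 := by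
    intro r b
    by_cases hb : b = r.length
    · subst hb; simp
    · rw [if_neg hb]
      rcases lt_or_gt_of_ne hb with hlt | hlt
      · rw [List.getD_append _ _ _ _ hlt]
      · rw [List.getD_eq_default, List.getD_eq_default]
        · omega
        · simp; omega
  funext ⟨a, b⟩
  cases t with
  | nil =>
    have := key [] b
    rw [rl_nil]
    cases a with
    | zero => 
      simp only [tabInsert, listEntry, Function.update_apply, Prod.mk.injEq, true_and]
      simpa using this
    | succ a => simp [tabInsert, listEntry]
  | cons r rs =>
    have hr : rowInsert x r = (r ++ [x], none) := rowInsert_big (fun y hy => h y (by simp [hy]))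
    rw [tabInsert_none rs (by rw [hr]), hr, rl_cons_zero]
    cases a with
    | zero =>
      simp only [listEntry, Function.update_apply, Prod.mk.injEq, true_and]
      simpa using key r b
    | succ a => simp [listEntry]

theorem SuppIn.succ {n : ℕ} {w : Equiv.Perm ℕ} (hw : SuppIn n w) : SuppIn (n + 1) w :=
  fun i hi => hw i (by omega)

theorem WT_succ_entry {n : ℕ} {w : Equiv.Perm ℕ} (hw : SuppIn n w) :
    listEntry (WT w (n + 1)) = Function.update (listEntry (WT w n)) (0, rl (WT w n) 0) (n + 1) := by
  rw [WT, hw (n + 1) (Or.inr (by omega))]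
  apply tabInsert_big
  intro y hy
  rw [WT_mem, perm_range hw] at hy
  omega

theorem Ptab_succ {n : ℕ} {w : Equiv.Perm ℕ} (hw : SuppIn n w) :
    Ptab (n + 1) w = Function.update (Ptab n w) (0, rl (WT w n) 0) (n + 1) := by
  rw [Ptab_eq, Ptab_eq, WT_succ_entry hw]

/-- `c` is in the shape after `m` steps. -/
def InS (w : Equiv.Perm ℕ) (m : ℕ) (c : ℕ × ℕ) : Prop := listEntry (WT w m) c ≠ 0

theorem Qtab_eq (n : ℕ) (w : Equiv.Perm ℕ) (c : ℕ × ℕ) :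
    Qtab n w c = sInf {m | InS w (min m n) c} := by
  simp only [Qtab, PLP_eq, InS]

theorem InS_zero (w : Equiv.Perm ℕ) (c : ℕ × ℕ) : ¬ InS w 0 c := by
  simp [InS, WT, listEntry]

theorem InS_step (w : Equiv.Perm ℕ) (h0 : w 0 = 0) (m : ℕ) :
    ∃ d, ¬ InS w m d ∧ ∀ c, InS w (m + 1) c ↔ (InS w m c ∨ c = d) := by
  obtain ⟨k, hk⟩ := rl_tabInsert (WT w m) (w (m + 1))
  refine ⟨(k, rl (WT w m) k), ?_, ?_⟩
  · rw [InS, entry_ne_zero w m h0]; omega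
  · rintro ⟨a, b⟩
    rw [InS, InS, entry_ne_zero w m h0, entry_ne_zero w _ h0, WT, hk, Prod.mk.injEq]
    by_cases ha : a = k
    · subst ha; simp; omega
    · simp [ha]

theorem InS_mono (w : Equiv.Perm ℕ) (h0 : w 0 = 0) (c : ℕ × ℕ) : ∀ {m k : ℕ}, m ≤ k →
    InS w m c → InS w k c := by
  intro m k hmk h
  induction hmk with
  | refl => exact h
  | step _ ih => 
    obtain ⟨d, _, hd⟩ := InS_step w h0 _
    exact (hd c).2 (Or.inl ih)

theorem Qtab_ne_zero {n : ℕ} {w : Equiv.Perm ℕ} (h0 : w 0 = 0) (c : ℕ × ℕ) :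
    Qtab n w c ≠ 0 ↔ InS w n c := by
  rw [Qtab_eq]
  constructor
  · intro h
    obtain ⟨m, hm⟩ := Nat.nonempty_of_pos_sInf (Nat.pos_of_ne_zero h)
    exact InS_mono w h0 c (min_le_right _ _) hm
  · intro h h'
    rcases Nat.sInf_eq_zero.1 h' with h1 | h1
    · simp [InS_zero] at h1
    · have : n ∈ {m | InS w (min m n) c} := by simpa using h
      rw [h1] at this; exact this

theorem Qtab_le {n : ℕ} {w : Equiv.Perm ℕ} (h0 : w 0 = 0) (c : ℕ × ℕ) : Qtab n w c ≤ n := by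
  by_cases h : Qtab n w c = 0
  · omega
  · have := (Qtab_ne_zero h0 c).1 h
    rw [Qtab_eq]
    exact Nat.sInf_le (by simpa using this)

theorem Qtab_val {n : ℕ} {w : Equiv.Perm ℕ} (h0 : w 0 = 0) (c : ℕ × ℕ) {v : ℕ} (hv : v < n) :
    Qtab n w c = v + 1 ↔ InS w (v + 1) c ∧ ¬ InS w v c := by
  constructor
  · intro h
    rw [Qtab_eq] at h
    constructor
    · have := Nat.sInf_mem (Nat.nonempty_of_pos_sInf (by rw [h]; omega))
      rw [h] at this
      simpa [min_eq_left (by omega : v + 1 ≤ n)] using this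
    · have : v ∉ {m | InS w (min m n) c} := Nat.notMem_of_lt_sInf (by omega)
      simpa [min_eq_left (by omega : v ≤ n)] using this
  · rintro ⟨h1, h2⟩
    rw [Qtab_eq]
    apply le_antisymm
    · apply Nat.sInf_le
      simpa [min_eq_left (by omega : v + 1 ≤ n)] using h1
    · have h3 : (v + 1) ∈ {m | InS w (min m n) c} := by
        simpa [min_eq_left (by omega : v + 1 ≤ n)] using h1
      have h4 := Nat.sInf_mem ⟨_, h3⟩
      by_contra h5
      apply h2
      exact InS_mono w h0 c (by omega) h4

theorem good_Q {n : ℕ} {w : Equiv.Perm ℕ} (hw : SuppIn n w) :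
    Good n (rl (WT w n) 0) (Qtab n w) := by
  have h0 : w 0 = 0 := hw 0 (Or.inl rfl)
  refine ⟨?_, Qtab_le h0, ?_, ?_, ?_⟩
  · intro v h1 h2
    obtain ⟨v, rfl⟩ : ∃ u, v = u + 1 := ⟨v - 1, by omega⟩
    obtain ⟨d, hd1, hd2⟩ := InS_step w h0 v
    exact ⟨d, (Qtab_val h0 d (by omega)).2 ⟨(hd2 d).2 (Or.inr rfl), hd1⟩⟩
  · intro c d hc he
    obtain ⟨v, hv⟩ : ∃ u, Qtab n w c = u + 1 := ⟨Qtab n w c - 1, by omega⟩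
    have hle := Qtab_le (n := n) h0 c
    have hc := (Qtab_val (n := n) h0 c (by omega)).1 hv
    have hd := (Qtab_val (n := n) h0 d (by omega)).1 (he ▸ hv)
    obtain ⟨e, _, he2⟩ := InS_step w h0 v
    have h1 := (he2 c).1 hc.1
    have h2 := (he2 d).1 hd.1
    rw [h1.resolve_left hc.2, h2.resolve_left hd.2]
  · intro a b a' b'
    rw [Qtab_ne_zero h0, Qtab_ne_zero h0, InS, InS, ← Ptab_eq]
    exact (good_P hw).low a b a' b'
  · intro j
    rw [Qtab_ne_zero h0, InS, ← Ptab_eq]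
    exact (good_P hw).row j

theorem Qtab_succ {n : ℕ} {w : Equiv.Perm ℕ} (hw : SuppIn n w) :
    Qtab (n + 1) w = Function.update (Qtab n w) (0, rl (WT w n) 0) (n + 1) := by
  have h0 : w 0 = 0 := hw 0 (Or.inl rfl)
  funext c
  by_cases hc : c = (0, rl (WT w n) 0)
  · rw [hc, Function.update_self, Qtab_val h0 _ (by omega), InS, InS, WT_succ_entry hw,
      Function.update_self]
    refine ⟨by omega, ?_⟩
    rw [entry_ne_zero w n h0]; omega
  · rw [Function.update_of_ne hc, Qtab_eq, Qtab_eq]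
    have hs : InS w (n + 1) c ↔ InS w n c := by
      rw [InS, InS, WT_succ_entry hw, Function.update_of_ne hc]
    congr 1
    ext m
    simp only [Set.mem_ofPred_eq]
    by_cases hm : m ≤ n
    · rw [min_eq_left hm, min_eq_left (by omega)]
    · rw [min_eq_right (by omega), min_eq_right (by omega), hs]

theorem Qt_succ {n : ℕ} {w : Equiv.Perm ℕ} (hw : SuppIn n w) :
    Qt (n + 1) w = shT (Qt n w) := by
  rw [Qt, Qt, evac, evac, Qtab_succ hw]
  exact evac_add n _ _ (good_Q hw)

theorem Qt_corner {n : ℕ} {w : Equiv.Perm ℕ} (hw : SuppIn n w) (hn : 1 ≤ n) :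
    Qt n w (0, 0) = 1 := by
  obtain ⟨m, rfl⟩ : ∃ m, n = m + 1 := ⟨n - 1, by omega⟩
  exact evac_corner m _ _ (good_Q hw)

/-! ### Cocharge of the shifted tableau -/

theorem rowIdx_shT (S : Tab) {i : ℕ} (hi : 1 ≤ i) : rowIdx (shT S) (i + 1) = rowIdx S i := by
  unfold rowIdx
  congr 1
  ext r
  simp only [Set.mem_ofPred_eq]
  constructor
  · rintro ⟨c, hc⟩
    unfold shT at hc
    by_cases hr : r = 0
    · subst hr
      by_cases hc0 : c = 0
      · subst hc0; simp at hc; omega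
      · refine ⟨c - 1, ?_⟩
        simp only [hc0, if_true, if_false] at hc
        split_ifs at hc <;> omega
    · refine ⟨c, ?_⟩
      simp only [hr, if_false] at hc
      split_ifs at hc <;> omega
  · rintro ⟨c, hc⟩
    by_cases hr : r = 0
    · subst hr
      exact ⟨c + 1, by simp [shT, hc]; omega⟩
    · exact ⟨c, by simp [shT, hc, hr]; omega⟩

theorem rowIdx_zero {S : Tab} {i b : ℕ} (h : S (0, b) = i) : rowIdx S i = 0 := by
  unfold rowIdx
  exact Nat.sInf_eq_zero.2 (Or.inl ⟨b, h⟩)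

theorem mem_Dsi_shT {n : ℕ} {S : Tab} (h1 : 1 ≤ n → S (0, 0) = 1) :
    DsiSet (n + 1) (shT S) = (DsiSet n S).image (· + 1) := by
  ext j
  simp only [DsiSet, Finset.mem_filter, Finset.mem_Ioo, Finset.mem_image]
  constructor
  · rintro ⟨⟨h2, h3⟩, h4⟩
    by_cases hj : j = 1
    · subst hj
      rw [rowIdx_shT S le_rfl, rowIdx_zero (h1 (by omega))] at h4
      omega
    · obtain ⟨i, rfl⟩ : ∃ i, j = i + 1 := ⟨j - 1, by omega⟩
      rw [rowIdx_shT S (by omega), rowIdx_shT S (by omega)] at h4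
      exact ⟨i, ⟨by omega, h4⟩, rfl⟩
  · rintro ⟨i, ⟨⟨h2, h3⟩, h4⟩, rfl⟩
    refine ⟨by omega, ?_⟩
    rwa [rowIdx_shT S (by omega), rowIdx_shT S (by omega)]

theorem ctEntry_shT {n : ℕ} {S : Tab} (h1 : 1 ≤ n → S (0, 0) = 1) (c : ℕ × ℕ) :
    ctEntry (shT S) (DsiSet (n + 1) (shT S)) (shC c) = ctEntry S (DsiSet n S) c := by
  have hv : shT S (shC c) = if S c = 0 then 0 else S c + 1 := by
    obtain ⟨a, b⟩ := c
    unfold shT shC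
    by_cases ha : a = 0
    · subst ha; simp
    · simp [ha]
  unfold ctEntry
  rw [mem_Dsi_shT h1, hv, Finset.filter_image, Finset.card_image_of_injective _ (add_left_injective 1)]
  congr 1
  apply Finset.filter_congr
  intro j _
  split_ifs <;> omega

theorem ctEntry_shT_zero {n : ℕ} {S : Tab} (h1 : 1 ≤ n → S (0, 0) = 1) :
    ctEntry (shT S) (DsiSet (n + 1) (shT S)) (0, 0) = 0 := by
  unfold ctEntry
  rw [mem_Dsi_shT h1]
  simp [shT]

/-! ### Embedded permutations -/

theorem embed_of_mem {n : ℕ} (σ : Equiv.Perm (Fin n)) (j : Fin n) :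
    embedPerm n σ ((j : ℕ) + 1) = (σ j : ℕ) + 1 := by
  have := Equiv.Perm.extendDomain_apply_image σ (finShift n) j
  exact this

theorem embed_mem {n : ℕ} (σ : Equiv.Perm (Fin n)) {i : ℕ} (hi : i ∈ Finset.Icc 1 n) :
    embedPerm n σ i ∈ Finset.Icc 1 n := by
  rw [Finset.mem_Icc] at hi
  have := embed_of_mem σ ⟨i - 1, by omega⟩
  simp only [Nat.sub_add_cancel hi.1] at this
  rw [this, Finset.mem_Icc]
  have := (σ ⟨i - 1, by omega⟩).isLt
  omega

theorem embed_supp {n : ℕ} (σ : Equiv.Perm (Fin n)) : SuppIn n (embedPerm n σ) := by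
  intro i hi
  exact Equiv.Perm.extendDomain_apply_not_subtype σ (finShift n) (by omega)

theorem embed_mem_iff {n : ℕ} (σ : Equiv.Perm (Fin n)) (i : ℕ) :
    i ∈ Finset.Icc 1 n ↔ embedPerm n σ i ∈ Finset.Icc 1 n := by
  refine ⟨embed_mem σ, fun h => ?_⟩
  by_contra hi
  rw [embed_supp σ i (by rw [Finset.mem_Icc] at hi; omega)] at h
  exact hi h

theorem embed_mul {n : ℕ} (σ τ : Equiv.Perm (Fin n)) :
    embedPerm n (σ * τ) = embedPerm n σ * embedPerm n τ :=
  (Equiv.Perm.extendDomain_mul _ σ τ).symm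

theorem embed_one {n : ℕ} : embedPerm n 1 = 1 := Equiv.Perm.extendDomain_one _

theorem embed_inv {n : ℕ} (σ : Equiv.Perm (Fin n)) : embedPerm n σ⁻¹ = (embedPerm n σ)⁻¹ :=
  (Equiv.Perm.extendDomain_inv σ _).symm

theorem embed_inj {n : ℕ} {σ τ : Equiv.Perm (Fin n)} (h : embedPerm n σ = embedPerm n τ) :
    σ = τ := by
  ext j
  have := congrArg (fun f : Equiv.Perm ℕ => f ((j : ℕ) + 1)) h
  simp only [embed_of_mem] at this
  omega

theorem embed_exists {N : ℕ} (g : ℕ → ℕ) (hg : ∀ i ∈ Finset.Icc 1 N, g i ∈ Finset.Icc 1 N)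
    (hi : ∀ i ∈ Finset.Icc 1 N, ∀ j ∈ Finset.Icc 1 N, g i = g j → i = j) :
    ∃ σ : Equiv.Perm (Fin N), ∀ i ∈ Finset.Icc 1 N, embedPerm N σ i = g i := by
  have hm : ∀ j : Fin N, (j : ℕ) + 1 ∈ Finset.Icc 1 N := fun j => by
    rw [Finset.mem_Icc]; omega
  have hlt : ∀ j : Fin N, g ((j : ℕ) + 1) - 1 < N := fun j => by
    have := hg _ (hm j); rw [Finset.mem_Icc] at this; omega
  let f : Fin N → Fin N := fun j => ⟨g ((j : ℕ) + 1) - 1, hlt j⟩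
  have hf : Function.Injective f := by
    intro a b hab
    have h1 : g ((a : ℕ) + 1) - 1 = g ((b : ℕ) + 1) - 1 := congrArg Fin.val hab
    have ha := Finset.mem_Icc.1 (hg _ (hm a))
    have hb := Finset.mem_Icc.1 (hg _ (hm b))
    have := hi _ (hm a) _ (hm b) (by omega)
    exact Fin.ext (by omega)
  refine ⟨Equiv.ofBijective f (Finite.injective_iff_bijective.1 hf), ?_⟩
  intro i hi'
  have hi2 := Finset.mem_Icc.1 hi'
  have := embed_of_mem (Equiv.ofBijective f (Finite.injective_iff_bijective.1 hf))
    ⟨i - 1, by omega⟩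
  simp only [Nat.sub_add_cancel hi2.1, Equiv.ofBijective_apply, f] at this
  rw [this]
  have := Finset.mem_Icc.1 (hg i hi')
  omega

theorem embed_of_supp {n : ℕ} {ρ : Equiv.Perm ℕ} (h : SuppIn n ρ) :
    ∃ σ : Equiv.Perm (Fin n), embedPerm n σ = ρ := by
  obtain ⟨σ, hσ⟩ := embed_exists (N := n) ρ (by
    intro i hi
    rw [Finset.mem_Icc] at hi ⊢
    have := (perm_range h (ρ i)).1 ⟨i - 1, by omega, by rw [Nat.sub_add_cancel hi.1]⟩
    exact this) (fun i _ j _ hij => ρ.injective hij)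
  refine ⟨σ, ?_⟩
  ext i
  by_cases hi : i ∈ Finset.Icc 1 n
  · exact hσ i hi
  · have hi' : i = 0 ∨ n < i := by rw [Finset.mem_Icc] at hi; omega
    rw [embed_supp σ i hi', h i hi']

def finLt (n : ℕ) : Fin n ≃ {x : Fin (n + 1) // (x : ℕ) < n} where
  toFun i := ⟨i.castSucc, i.isLt⟩
  invFun x := ⟨x.1, x.2⟩
  left_inv _ := rfl
  right_inv _ := rfl

def iotaP (n : ℕ) (σ : Equiv.Perm (Fin n)) : Equiv.Perm (Fin (n + 1)) := σ.extendDomain (finLt n)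

theorem sign_iotaP {n : ℕ} (σ : Equiv.Perm (Fin n)) :
    Equiv.Perm.sign (iotaP n σ) = Equiv.Perm.sign σ := Equiv.Perm.sign_extendDomain _ _

theorem embed_iotaP {n : ℕ} (σ : Equiv.Perm (Fin n)) :
    embedPerm (n + 1) (iotaP n σ) = embedPerm n σ := by
  ext i
  by_cases hi : i ∈ Finset.Icc 1 n
  · rw [Finset.mem_Icc] at hi
    have h1 := embed_of_mem σ ⟨i - 1, by omega⟩
    have h2 := embed_of_mem (iotaP n σ) ⟨i - 1, by omega⟩
    simp only [Nat.sub_add_cancel hi.1] at h1 h2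
    rw [h1, h2]
    have h3 := Equiv.Perm.extendDomain_apply_image σ (finLt n) ⟨i - 1, by omega⟩
    have h4 := congrArg Fin.val h3
    have h5 : ((iotaP n σ) ⟨i - 1, by omega⟩ : ℕ) = σ ⟨i - 1, by omega⟩ := h4
    rw [h5]
  · rw [Finset.mem_Icc] at hi
    rw [embed_supp σ i (by omega)]
    by_cases hi2 : i = n + 1
    · subst hi2
      have h2 := embed_of_mem (iotaP n σ) (Fin.last n)
      have h3 : iotaP n σ (Fin.last n) = Fin.last n :=
        Equiv.Perm.extendDomain_apply_not_subtype σ (finLt n) (by simp)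
      rw [h3] at h2
      simpa using h2
    · exact embed_supp _ i (by omega)

/-! ### Orbit sums -/

theorem row_mul {n : ℕ} {T : Tab} {σ τ : Equiv.Perm (Fin n)} (h1 : σ ∈ rowFinset n T)
    (h2 : τ ∈ rowFinset n T) : σ * τ ∈ rowFinset n T := by
  simp only [rowFinset, Finset.mem_filter, Finset.mem_univ, true_and] at *
  intro i hi
  rw [embed_mul, Equiv.Perm.mul_apply, h1 _ (embed_mem τ hi), h2 i hi]

theorem row_one {n : ℕ} {T : Tab} : (1 : Equiv.Perm (Fin n)) ∈ rowFinset n T := by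
  simp [rowFinset, embed_one]

theorem row_inv {n : ℕ} {T : Tab} {σ : Equiv.Perm (Fin n)} (h1 : σ ∈ rowFinset n T) :
    σ⁻¹ ∈ rowFinset n T := by
  simp only [rowFinset, Finset.mem_filter, Finset.mem_univ, true_and] at *
  intro i hi
  have := h1 _ (embed_mem σ⁻¹ hi)
  rw [← this, embed_inv]
  simp

/-- the action on polynomials -/
def act (n : ℕ) (σ : Equiv.Perm (Fin n)) (p : MvPolynomial ℕ ℚ) : MvPolynomial ℕ ℚ :=
  rename (⇑(embedPerm n σ)) p

theorem act_mul {n : ℕ} (σ τ : Equiv.Perm (Fin n)) (p : MvPolynomial ℕ ℚ) :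
    act n (σ * τ) p = act n σ (act n τ p) := by
  rw [act, act, act, rename_rename, embed_mul, Equiv.Perm.coe_mul]

theorem act_one {n : ℕ} (p : MvPolynomial ℕ ℚ) : act n 1 p = p := by
  rw [act, embed_one, Equiv.Perm.coe_one, rename_id_apply]

def orb (n : ℕ) (T : Tab) (p : MvPolynomial ℕ ℚ) : Finset (MvPolynomial ℕ ℚ) :=
  (rowFinset n T).image fun τ => act n τ p

def colAct (n : ℕ) (T : Tab) (q : MvPolynomial ℕ ℚ) : MvPolynomial ℕ ℚ :=
  ∑ σ ∈ colFinset n T, (Equiv.Perm.sign σ : ℤ) • rename (⇑(embedPerm n σ)) q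

theorem epsAct_eq (n : ℕ) (T : Tab) (p : MvPolynomial ℕ ℚ) :
    epsAct n T p = ∑ τ ∈ rowFinset n T, colAct n T (act n τ p) := by
  rw [epsAct, Finset.sum_comm]
  refine Finset.sum_congr rfl fun τ _ => ?_
  rw [colAct]
  refine Finset.sum_congr rfl fun σ _ => ?_
  rw [act, rename_rename, Equiv.Perm.coe_mul]

theorem row_sum_mul {n : ℕ} {T : Tab} {π : Equiv.Perm (Fin n)} (h : π ∈ rowFinset n T)
    (p : MvPolynomial ℕ ℚ) : epsAct n T (act n π p) = epsAct n T p := by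
  rw [epsAct_eq, epsAct_eq]
  refine Finset.sum_bij' (fun τ _ => τ * π) (fun τ _ => τ * π⁻¹) ?_ ?_ ?_ ?_ ?_
  · intro τ hτ; exact row_mul hτ h
  · intro τ hτ; exact row_mul hτ (row_inv h)
  · intro τ _; simp
  · intro τ _; simp
  · intro τ _; rw [act_mul]

theorem orb_mul {n : ℕ} {T : Tab} {π : Equiv.Perm (Fin n)} (h : π ∈ rowFinset n T)
    (p : MvPolynomial ℕ ℚ) : orb n T (act n π p) = orb n T p := by
  ext q
  simp only [orb, Finset.mem_image]
  constructor
  · rintro ⟨τ, hτ, rfl⟩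
    exact ⟨τ * π, row_mul hτ h, by rw [act_mul]⟩
  · rintro ⟨τ, hτ, rfl⟩
    exact ⟨τ * π⁻¹, row_mul hτ (row_inv h), by rw [← act_mul]; simp⟩

theorem FTS_eq (n : ℕ) (T S : Tab) :
    FTS n T S = ∑ q ∈ orb n T (pTS n T S), colAct n T q := by
  have hs : (sTS n T S : ℚ) ≠ 0 := by
    rw [Nat.cast_ne_zero, sTS, Finset.card_ne_zero]
    refine ⟨1, Finset.mem_filter.2 ⟨row_one, ?_⟩⟩
    exact act_one _
  rw [FTS, epsAct_eq, Finset.sum_comp (colAct n T) (fun τ => act n τ (pTS n T S))]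
  have : ∀ q ∈ (rowFinset n T).image (fun τ => act n τ (pTS n T S)),
      ((rowFinset n T).filter fun τ => act n τ (pTS n T S) = q).card • colAct n T q =
        (sTS n T S : ℚ) • colAct n T q := by
    intro q hq
    obtain ⟨τ, hτ, rfl⟩ := Finset.mem_image.1 hq
    rw [← Nat.cast_smul_eq_nsmul ℚ]
    congr 2
    rw [sTS]
    symm
    refine Finset.card_bij' (fun ρ _ => τ * ρ) (fun ρ _ => τ⁻¹ * ρ) ?_ ?_ ?_ ?_
    · intro ρ hρ
      rw [Finset.mem_filter] at hρ ⊢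
      refine ⟨row_mul hτ hρ.1, ?_⟩
      rw [act_mul]
      exact congrArg _ hρ.2
    · intro ρ hρ
      rw [Finset.mem_filter] at hρ ⊢
      refine ⟨row_mul (row_inv hτ) hρ.1, ?_⟩
      change act n _ _ = _
      rw [act_mul, hρ.2, ← act_mul]
      simp [act_one]
    · intro ρ _; simp
    · intro ρ _; simp
  rw [Finset.sum_congr rfl this, ← Finset.smul_sum, smul_smul, inv_mul_cancel₀ hs, one_smul, orb]

/-! ### Comparison of the two groups -/

/-- `Tp` is `T` with `n+1` added in a new column. -/
structure Ext (n : ℕ) (T Tp : Tab) : Prop where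
  row : ∀ i ∈ Finset.Icc 1 n, rowIdx Tp i = rowIdx T i
  col : ∀ i ∈ Finset.Icc 1 n, colIdx Tp i = colIdx T i
  new : ∀ i ∈ Finset.Icc 1 n, colIdx Tp i ≠ colIdx Tp (n + 1)

theorem mem_Icc_succ {n i : ℕ} (h : i ∈ Finset.Icc 1 (n + 1)) : i ∈ Finset.Icc 1 n ∨ i = n + 1 := by
  rw [Finset.mem_Icc] at *; omega

theorem Ext.iota_row {n : ℕ} {T Tp : Tab} (h : Ext n T Tp) {σ : Equiv.Perm (Fin n)}
    (hσ : σ ∈ rowFinset n T) : iotaP n σ ∈ rowFinset (n + 1) Tp := by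
  simp only [rowFinset, Finset.mem_filter, Finset.mem_univ, true_and] at *
  intro i hi
  rw [embed_iotaP]
  rcases mem_Icc_succ hi with hi | rfl
  · rw [h.row _ (embed_mem σ hi), h.row _ hi, hσ i hi]
  · rw [embed_supp σ _ (Or.inr (by omega))]

theorem Ext.iota_col {n : ℕ} {T Tp : Tab} (h : Ext n T Tp) {σ : Equiv.Perm (Fin n)}
    (hσ : σ ∈ colFinset n T) : iotaP n σ ∈ colFinset (n + 1) Tp := by
  simp only [colFinset, Finset.mem_filter, Finset.mem_univ, true_and] at *
  intro i hi
  rw [embed_iotaP]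
  rcases mem_Icc_succ hi with hi | rfl
  · rw [h.col _ (embed_mem σ hi), h.col _ hi, hσ i hi]
  · rw [embed_supp σ _ (Or.inr (by omega))]

theorem Ext.colAct_eq {n : ℕ} {T Tp : Tab} (h : Ext n T Tp) (q : MvPolynomial ℕ ℚ) :
    colAct (n + 1) Tp q = colAct n T q := by
  symm
  unfold colAct
  refine Finset.sum_bij (fun σ _ => iotaP n σ) (fun σ hσ => h.iota_col hσ) ?_ ?_ ?_
  · intro σ _ τ _ he
    apply embed_inj
    rw [← embed_iotaP σ, ← embed_iotaP τ, he]
  · intro σ hσ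
    have hs := hσ
    simp only [colFinset, Finset.mem_filter, Finset.mem_univ, true_and] at hs
    have hmem : n + 1 ∈ Finset.Icc 1 (n + 1) := by simp
    have hfix : embedPerm (n + 1) σ (n + 1) = n + 1 := by
      rcases mem_Icc_succ (embed_mem σ hmem) with hi | hi
      · exact absurd (hs _ hmem) (h.new _ hi)
      · exact hi
    obtain ⟨ρ, hρ⟩ := embed_of_supp (n := n) (ρ := embedPerm (n + 1) σ) (by
      intro i hi
      by_cases h2 : i = n + 1
      · rw [h2, hfix]
      · exact embed_supp σ i (by omega))
    refine ⟨ρ, ?_, ?_⟩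
    · simp only [colFinset, Finset.mem_filter, Finset.mem_univ, true_and]
      intro i hi
      rw [← h.col _ (embed_mem ρ hi), ← h.col _ hi, hρ]
      exact hs i (by rw [Finset.mem_Icc] at *; omega)
    · apply embed_inj
      rw [embed_iotaP, hρ]
  · intro σ _
    rw [sign_iotaP, embed_iotaP]

/-- the monomial with exponents `h` -/
def mon (n : ℕ) (h : ℕ → ℕ) : MvPolynomial ℕ ℚ := ∏ i ∈ Finset.Icc 1 n, X i ^ h i

def kill (n : ℕ) : MvPolynomial ℕ ℚ →ₐ[ℚ] MvPolynomial ℕ ℚ :=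
  aeval (fun i : ℕ => if i = n + 1 then (0 : MvPolynomial ℕ ℚ) else X i)

theorem rename_mon (n : ℕ) (h : ℕ → ℕ) (ρ : ℕ → ℕ) :
    rename ρ (mon n h) = ∏ i ∈ Finset.Icc 1 n, X (ρ i) ^ h i := by
  simp [mon, map_prod]

theorem kill_rename (n : ℕ) (h : ℕ → ℕ) (ρ : ℕ → ℕ)
    (hρ : ∀ i ∈ Finset.Icc 1 n, h i ≠ 0 → ρ i ≠ n + 1) :
    kill n (rename ρ (mon n h)) = rename ρ (mon n h) := by
  rw [rename_mon, map_prod]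
  refine Finset.prod_congr rfl fun i hi => ?_
  by_cases h0 : h i = 0
  · simp [h0]
  · simp [kill, hρ i hi h0]

theorem kill_rename_zero (n : ℕ) (h : ℕ → ℕ) (ρ : ℕ → ℕ) {i : ℕ} (hi : i ∈ Finset.Icc 1 n)
    (h0 : h i ≠ 0) (hρ : ρ i = n + 1) : kill n (rename ρ (mon n h)) = 0 := by
  rw [rename_mon, map_prod]
  refine Finset.prod_eq_zero hi ?_
  simp [kill, hρ, h0]

theorem kill_colAct (n : ℕ) (T : Tab) (q : MvPolynomial ℕ ℚ) :
    kill n (colAct n T q) = ∑ σ ∈ colFinset n T,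
      (Equiv.Perm.sign σ : ℤ) • kill n (rename (⇑(embedPerm n σ)) q) := by
  rw [colAct, map_sum]
  refine Finset.sum_congr rfl fun σ _ => ?_
  rw [map_zsmul]

theorem Ext.kill_sum {n : ℕ} {T Tp : Tab} (h : Ext n T Tp) (e : ℕ → ℕ) :
    kill n (∑ q ∈ orb (n + 1) Tp (mon n e), colAct (n + 1) Tp q) =
      ∑ q ∈ orb n T (mon n e), colAct n T q := by
  rw [map_sum]
  have hsub : orb n T (mon n e) ⊆ orb (n + 1) Tp (mon n e) := by
    intro q hq
    obtain ⟨τ, hτ, rfl⟩ := Finset.mem_image.1 hq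
    refine Finset.mem_image.2 ⟨iotaP n τ, h.iota_row hτ, ?_⟩
    rw [act, act, embed_iotaP]
  rw [← Finset.sum_subset hsub]
  · refine Finset.sum_congr rfl fun q hq => ?_
    obtain ⟨τ, hτ, rfl⟩ := Finset.mem_image.1 hq
    rw [h.colAct_eq, kill_colAct, colAct]
    refine Finset.sum_congr rfl fun σ _ => ?_
    rw [act, rename_rename, kill_rename]
    intro i hi _
    have := embed_mem σ (embed_mem τ hi)
    rw [Finset.mem_Icc] at this
    simp only [Function.comp_apply]
    omega
  · intro q hq hnq
    obtain ⟨τ, hτ, rfl⟩ := Finset.mem_image.1 hq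
    rw [h.colAct_eq, kill_colAct]
    by_cases hex : ∃ i ∈ Finset.Icc 1 n, e i ≠ 0 ∧ embedPerm (n + 1) τ i = n + 1
    · obtain ⟨i, hi, h0, hτi⟩ := hex
      refine Finset.sum_eq_zero fun σ _ => ?_
      rw [act, rename_rename, kill_rename_zero n e _ hi h0, smul_zero]
      simp only [Function.comp_apply, hτi]
      exact embed_supp σ _ (Or.inr (by omega))
    · exfalso
      apply hnq
      push Not at hex
      have hs := hτ
      simp only [rowFinset, Finset.mem_filter, Finset.mem_univ, true_and] at hs
      set ρ := embedPerm (n + 1) τ with hρ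
      have hmem : n + 1 ∈ Finset.Icc 1 (n + 1) := by simp
      set j := ρ⁻¹ (n + 1) with hj
      have hρj : ρ j = n + 1 := by simp [hj]
      have hjm : j ∈ Finset.Icc 1 (n + 1) := by
        rw [embed_mem_iff τ, ← hρ, hρj]; exact hmem
      obtain ⟨τ', hτ'⟩ := embed_of_supp (n := n) (ρ := ρ * Equiv.swap j (n + 1)) (by
        intro i hi
        rw [Equiv.Perm.mul_apply]
        by_cases h2 : i = n + 1
        · rw [h2, Equiv.swap_apply_right, hρj]
        · have : i ≠ j := by
            rintro h3; rw [← h3, Finset.mem_Icc] at hjm; omega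
          rw [Equiv.swap_apply_of_ne_of_ne this h2]
          exact embed_supp τ i (by omega))
      refine Finset.mem_image.2 ⟨τ', ?_, ?_⟩
      · simp only [rowFinset, Finset.mem_filter, Finset.mem_univ, true_and]
        intro i hi
        rw [← h.row _ (embed_mem τ' hi), ← h.row _ hi, hτ', Equiv.Perm.mul_apply]
        have hi2 := Finset.mem_Icc.1 hi
        by_cases hij : i = j
        · rw [hij, Equiv.swap_apply_left, hs _ hmem, ← hρj, hs _ hjm]
        · rw [Equiv.swap_apply_of_ne_of_ne hij (by omega)]
          exact hs i (Finset.mem_Icc.2 (by omega))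
      · rw [act, act, rename_mon, rename_mon, hτ']
        refine Finset.prod_congr rfl fun i hi => ?_
        have hi2 := Finset.mem_Icc.1 hi
        by_cases hij : i = j
        · have : e i = 0 := by
            by_contra h0
            exact hex i hi h0 (by rw [hij, hρj])
          rw [this]; simp
        · rw [Equiv.Perm.mul_apply, Equiv.swap_apply_of_ne_of_ne hij (by omega)]

theorem posOf_unique {m L : ℕ} {T : Tab} (h : Good m L T) {c : ℕ × ℕ} (hc : T c ≠ 0) :
    posOf T (T c) = c := by
  have := posOf_spec (T := T) (i := T c) ⟨c, rfl⟩
  exact h.inj _ _ (by omega) this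

theorem good_zero {n L : ℕ} {T : Tab} (h : Good n L T) : T (0, L) = 0 := by
  by_contra h0
  have := (h.row L).1 h0
  omega

theorem posOf_update {n L : ℕ} {T : Tab} (h : Good n L T) {i : ℕ} (hi : i ∈ Finset.Icc 1 n) :
    posOf (Function.update T (0, L) (n + 1)) i = posOf T i := by
  apply posOf_congr
  intro c
  rw [Finset.mem_Icc] at hi
  by_cases hc : c = (0, L)
  · subst hc; rw [Function.update_self, good_zero h]; omega
  · rw [Function.update_of_ne hc]

theorem posOf_update_new {n L : ℕ} {T : Tab} (h : Good n L T) :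
    posOf (Function.update T (0, L) (n + 1)) (n + 1) = (0, L) := by
  have := posOf_spec (T := Function.update T (0, L) (n + 1)) (i := n + 1) ⟨(0, L), by simp⟩
  by_contra hne
  rw [Function.update_of_ne hne] at this
  have := h.le (posOf (Function.update T (0, L) (n + 1)) (n + 1))
  omega

theorem posOf_val {n L : ℕ} {T : Tab} (h : Good n L T) {i : ℕ} (hi : i ∈ Finset.Icc 1 n) :
    T (posOf T i) = i := by
  rw [Finset.mem_Icc] at hi
  exact posOf_spec (h.surj i hi.1 hi.2)

theorem ext_update {n L : ℕ} {T : Tab} (h : Good n L T) :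
    Ext n T (Function.update T (0, L) (n + 1)) := by
  refine ⟨fun i hi => congrArg Prod.fst (posOf_update h hi),
    fun i hi => congrArg Prod.snd (posOf_update h hi), fun i hi he => ?_⟩
  have h1 : colIdx (Function.update T (0, L) (n + 1)) i = colIdx T i :=
    congrArg Prod.snd (posOf_update h hi)
  have h2 : colIdx (Function.update T (0, L) (n + 1)) (n + 1) = L :=
    congrArg Prod.snd (posOf_update_new h)
  have h3 := posOf_val h hi
  rw [Finset.mem_Icc] at hi
  have h4 := h.low _ _ 0 (colIdx T i) (show T (rowIdx T i, colIdx T i) ≠ 0 by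
    change T (posOf T i) ≠ 0; omega) (by omega) le_rfl
  rw [h.row] at h4
  omega

/-- The permutation rotating the first row. -/
theorem rotate_exists {n L : ℕ} {T S : Tab} (h : Good n L T) (h1 : 1 ≤ n → S (0, 0) = 1) :
    ∃ π ∈ rowFinset (n + 1) (Function.update T (0, L) (n + 1)),
      act (n + 1) π (pTS (n + 1) (Function.update T (0, L) (n + 1)) (shT S)) = pTS n T S := by
  set Tp := Function.update T (0, L) (n + 1) with hTp
  -- the rotation on cells
  let f : ℕ × ℕ → ℕ × ℕ := fun c =>
    if c.1 = 0 then (if c.2 = 0 then (0, L) else (0, c.2 - 1)) else c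
  have hval : ∀ i ∈ Finset.Icc 1 (n + 1), Tp (posOf Tp i) = i := by
    intro i hi
    rcases mem_Icc_succ hi with hi | rfl
    · exact posOf_spec ⟨posOf T i, by
        rw [hTp, Function.update_of_ne, posOf_val h hi]
        intro h2
        have := posOf_val h hi
        rw [h2, good_zero h] at this
        rw [Finset.mem_Icc] at hi
        omega⟩
    · exact posOf_spec ⟨(0, L), by simp [hTp]⟩
  have hpos : ∀ c, Tp c ≠ 0 → Tp c ∈ Finset.Icc 1 (n + 1) ∧ posOf Tp (Tp c) = c := by
    intro c hc
    by_cases hcL : c = (0, L)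
    · subst hcL
      rw [show Tp (0, L) = n + 1 by simp [hTp]]
      exact ⟨by simp, posOf_update_new h⟩
    · have h2 : Tp c = T c := by rw [hTp, Function.update_of_ne hcL]
      rw [h2] at hc ⊢
      have h3 := h.le c
      refine ⟨Finset.mem_Icc.2 (by omega), ?_⟩
      rw [hTp, posOf_update h (Finset.mem_Icc.2 (by omega)), posOf_unique h hc]
  have hrow : ∀ j, Tp (0, j) ≠ 0 ↔ j ≤ L := by
    intro j
    by_cases hj : j = L
    · subst hj; simp [hTp]
    · rw [hTp, Function.update_of_ne (by simpa using hj), h.row]; omega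
  have hf : ∀ c, Tp c ≠ 0 → Tp (f c) ≠ 0 := by
    rintro ⟨a, b⟩ hc
    by_cases ha : a = 0
    · subst ha
      rw [hrow] at hc
      by_cases hb : b = 0
      · simp only [f, hb, if_true]; rw [hrow]
      · simp only [f, hb, if_true, if_false]; rw [hrow]; omega
    · simpa only [f, ha, if_false] using hc
  have hfinj : ∀ c d, Tp c ≠ 0 → Tp d ≠ 0 → f c = f d → c = d := by
    rintro ⟨a, b⟩ ⟨a', b'⟩ hc hd he
    simp only [f] at he
    by_cases ha : a = 0
    · subst ha
      rw [hrow] at hc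
      by_cases ha' : a' = 0
      · subst ha'
        rw [hrow] at hd
        by_cases hb : b = 0 <;> by_cases hb' : b' = 0 <;>
          simp [hb, hb'] at he ⊢ <;> omega
      · by_cases hb : b = 0 <;> simp [hb, ha'] at he <;> omega
    · by_cases ha' : a' = 0
      · subst ha'
        by_cases hb : b' = 0 <;> simp [hb, ha] at he
      · simpa [ha, ha'] using he
  have hnz : ∀ i ∈ Finset.Icc 1 (n + 1), Tp (posOf Tp i) ≠ 0 := by
    intro i hi
    rw [hval i hi]
    rw [Finset.mem_Icc] at hi
    omega
  obtain ⟨π, hπ⟩ := embed_exists (N := n + 1) (fun i => Tp (f (posOf Tp i)))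
    (fun i hi => (hpos _ (hf _ (hnz i hi))).1) (by
      intro i hi j hj he
      have h2 := (hpos _ (hf _ (hnz i hi))).2
      have h3 := (hpos _ (hf _ (hnz j hj))).2
      rw [he, h3] at h2
      have h4 := hfinj _ _ (hnz i hi) (hnz j hj) h2.symm
      rw [← hval i hi, ← hval j hj, h4])
  have hπpos : ∀ i ∈ Finset.Icc 1 (n + 1), posOf Tp (embedPerm (n + 1) π i) = f (posOf Tp i) := by
    intro i hi
    rw [hπ i hi]
    exact (hpos _ (hf _ (hnz i hi))).2
  refine ⟨π, ?_, ?_⟩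
  · simp only [rowFinset, Finset.mem_filter, Finset.mem_univ, true_and]
    intro i hi
    have h2 := congrArg Prod.fst (hπpos i hi)
    change rowIdx Tp _ = _ at h2
    rw [h2]
    change _ = (posOf Tp i).1
    simp only [f]
    split_ifs with h3 h4
    · exact h3.symm
    · exact h3.symm
    · rfl
  · let e : ℕ → ℕ := fun i => ctEntry S (DsiSet n S) (posOf T i)
    let e' : ℕ → ℕ := fun i => if i = n + 1 then 0 else e i
    have hkey : ∀ i ∈ Finset.Icc 1 (n + 1),
        ctEntry (shT S) (DsiSet (n + 1) (shT S)) (posOf Tp i) = e' (embedPerm (n + 1) π i) := by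
      intro i hi
      have h2 := hπpos i hi
      have h3 := embed_mem π hi
      generalize embedPerm (n + 1) π i = k at h2 h3
      have hc := hnz i hi
      generalize posOf Tp i = c at h2 hc
      have hkL : k = n + 1 ↔ f c = (0, L) := by
        constructor
        · rintro rfl; rw [← h2]; exact posOf_update_new h
        · intro h4
          rw [← hval k h3, h2, h4]; simp [hTp]
      by_cases hk : k = n + 1
      · simp only [e', hk, if_true]
        have h4 := hkL.1 hk
        have : c = (0, 0) := by
          apply hfinj _ _ hc
          · rw [hrow]; omega
          · rw [h4]; simp [f]
        rw [this, ctEntry_shT_zero h1]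
      · simp only [e', hk, if_false, e]
        have hkn : k ∈ Finset.Icc 1 n := (mem_Icc_succ h3).resolve_right hk
        rw [← ctEntry_shT h1, ← posOf_update h hkn, ← hTp, h2]
        congr 1
        have h5 : f c ≠ (0, L) := fun h6 => hk (hkL.2 h6)
        obtain ⟨a, b⟩ := c
        by_cases ha : a = 0
        · subst ha
          by_cases hb : b = 0
          · exact absurd (by simp [f, hb]) h5
          · simp [f, hb, shC]; omega
        · simp [f, ha, shC]
    have h2 : pTS (n + 1) Tp (shT S) = mon (n + 1) (fun i => e' (embedPerm (n + 1) π i)) := by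
      unfold pTS mon
      exact Finset.prod_congr rfl fun i hi => by rw [hkey i hi]
    rw [h2, act, rename_mon]
    rw [Finset.prod_equiv (t := Finset.Icc 1 (n + 1)) (embedPerm (n + 1) π) (g := fun i => (X i : MvPolynomial ℕ ℚ) ^ e' i)
      (fun i => embed_mem_iff π i) (fun i _ => rfl)]
    rw [Finset.prod_Icc_succ_top (by omega)]
    simp only [e', if_true, pow_zero, mul_one, pTS]
    refine Finset.prod_congr rfl fun i hi => ?_
    rw [Finset.mem_Icc] at hi
    rw [if_neg (by omega)]

theorem pTS_mon (n : ℕ) (T S : Tab) :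
    pTS n T S = mon n (fun i => ctEntry S (DsiSet n S) (posOf T i)) := rfl


/-- For `w ∈ Sₙ` and `w₊ ∈ S_{n+1}` acting as `w` on `{1,…,n}` and fixing
`n+1` (the same permutation of `ℕ` in this encoding), the higher Specht polynomial `F_{w₊}`
equals `(1/s_{P(w₊)}^{Q̃(w₊)}) · ε_{P(w₊)}` applied to the monomial `p_{P(w)}^{Q̃(w)}`, and
substituting `x_{n+1} = 0` into `F_{w₊}` yields `F_w`. -/
theorem statement_7 (n : ℕ) (w : Equiv.Perm ℕ) (hw : SuppIn n w) :
    Fw (n + 1) w =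
      ((sTS (n + 1) (Ptab (n + 1) w) (Qt (n + 1) w) : ℚ)⁻¹) •
        epsAct (n + 1) (Ptab (n + 1) w) (pTS n (Ptab n w) (Qt n w)) ∧
    aeval (fun i : ℕ => if i = n + 1 then (0 : MvPolynomial ℕ ℚ) else X i)
        (Fw (n + 1) w) = Fw n w := by
  have hP := good_P hw
  obtain ⟨π, hπ, he⟩ := rotate_exists (S := Qt n w) hP (Qt_corner hw)
  rw [← Ptab_succ hw, ← Qt_succ hw] at he
  rw [← Ptab_succ hw] at hπ
  constructor
  · rw [← he, row_sum_mul hπ, Fw, FTS]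
  · have hE : Ext n (Ptab n w) (Ptab (n + 1) w) := by
      rw [Ptab_succ hw]; exact ext_update hP
    rw [Fw, Fw, FTS_eq, FTS_eq, ← orb_mul hπ, he, pTS_mon]
    exact hE.kill_sum _

end HigherSpecht
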